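/- arXiv:math/9803117 — 3 statements merged into one kernel-verified Lean document; each statement's English description precedes it below -/
import Mathlib

section
/- Let 0 < r < R < ∞, let φ be a holomorphic function on the ball B(R) ⊆ l¹ with monomial coefficients (a_k), and let ε > 0. Then there exists a holomorphic function ψ on all of l¹, with monomial coefficients (b_k), such that sup_k |a_k − b_k|·r^{‖k‖}·k^k/‖k‖^{‖k‖} ≤ ε. -/
open Set
open scoped ENNReal NNReal

noncomputable section

/-- `l¹`: the space of absolutely summable sequences of complex numbers. -/
abbrev L1 : Type := lp (fun _ : ℕ => ℂ) 1

/-- `ℂ^N` equipped with the `l¹` norm. -/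
abbrev EN (N : ℕ) : Type := PiLp 1 (fun _ : Fin N => ℂ)

/-- The `(0,1)`-part of the real Fréchet derivative of `u` at `z`, applied to `ξ`:
`∂̄u(z)(ξ) = (Du(z)(ξ) + i·Du(z)(iξ))/2`. -/
noncomputable def dbar {V : Type*} [NormedAddCommGroup V] [NormedSpace ℂ V]
    (u : V → ℂ) (z ξ : V) : ℂ :=
  (fderiv ℝ u z ξ + Complex.I * fderiv ℝ u z (Complex.I • ξ)) / 2

/-- `f` is a `(0,1)`-form of class `C^m` on `Ω`: each `f z` is (continuous) conjugate-linear
and `(z,ξ) ↦ f z ξ` is `m` times continuously differentiable in the real sense on `Ω × V`. -/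
def IsForm01 {V : Type*} [NormedAddCommGroup V] [NormedSpace ℂ V]
    (m : ℕ) (Ω : Set V) (f : V → V → ℂ) : Prop :=
  (∀ z ∈ Ω, ∀ ξ η : V, f z (ξ + η) = f z ξ + f z η) ∧
  (∀ z ∈ Ω, ∀ (a : ℂ) (ξ : V), f z (a • ξ) = (starRingEnd ℂ) a * f z ξ) ∧
  ContDiffOn ℝ m (fun p : V × V => f p.1 p.2) (Ω ×ˢ (univ : Set V))

/-- A `(0,1)`-form `f` is `∂̄`-closed on `Ω`. -/
def DbarClosed {V : Type*} [NormedAddCommGroup V] [NormedSpace ℂ V]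
    (Ω : Set V) (f : V → V → ℂ) : Prop :=
  ∀ z ∈ Ω, ∀ ξ η : V, dbar (fun w => f w ξ) z η = dbar (fun w => f w η) z ξ

/-- The set of values `‖f z ξ‖`, `z ∈ A`, `‖ξ‖ ≤ 1`; its sup is `|f|_{0,A}`. -/
def formSet0 {V : Type*} [NormedAddCommGroup V]
    (f : V → V → ℂ) (A : Set V) : Set ℝ :=
  {x | ∃ z ∈ A, ∃ ξ : V, ‖ξ‖ ≤ 1 ∧ x = ‖f z ξ‖}

/-- The set of difference quotients `‖f z ξ - f w ξ‖/‖z-w‖`; its sup is `|f|_{1,A}`. -/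
def formSet1 {V : Type*} [NormedAddCommGroup V]
    (f : V → V → ℂ) (A : Set V) : Set ℝ :=
  {x | ∃ z ∈ A, ∃ w ∈ A, z ≠ w ∧ ∃ ξ : V, ‖ξ‖ ≤ 1 ∧ x = ‖f z ξ - f w ξ‖ / ‖z - w‖}

/-- `|f|_{0,A}`. -/
noncomputable def formNorm0 {V : Type*} [NormedAddCommGroup V]
    (f : V → V → ℂ) (A : Set V) : ℝ := sSup (formSet0 f A)

/-- `|f|_{1,A}`. -/
noncomputable def formNorm1 {V : Type*} [NormedAddCommGroup V]
    (f : V → V → ℂ) (A : Set V) : ℝ := sSup (formSet1 f A)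

/-- `f` is Lipschitz continuous on `A`: `|f|_{0,A} < ∞` and `|f|_{1,A} < ∞`. -/
def LipschitzForm {V : Type*} [NormedAddCommGroup V]
    (f : V → V → ℂ) (A : Set V) : Prop :=
  BddAbove (formSet0 f A) ∧ BddAbove (formSet1 f A)

/-- `‖k‖ = ∑_ν k_ν` for a multiindex `k`. -/
def knormN (k : ℕ →₀ ℕ) : ℕ := k.sum fun _ m => m

/-- `k^k = ∏_ν k_ν^{k_ν}` (with `0^0 = 1`). -/
noncomputable def kk (k : ℕ →₀ ℕ) : ℝ := ∏ ν ∈ k.support, (k ν : ℝ) ^ k ν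

/-- `‖k‖^{‖k‖}` (with `0^0 = 1`). -/
noncomputable def nn (k : ℕ →₀ ℕ) : ℝ := ((knormN k : ℝ)) ^ knormN k

/-- The monomial `z^k = ∏_ν z_ν^{k_ν}` (with `0^0 = 1`). -/
noncomputable def monom (k : ℕ →₀ ℕ) (z : ℕ → ℂ) : ℂ := ∏ ν ∈ k.support, z ν ^ k ν

/-- The term of the series defining `Δ(q,z)` corresponding to the multiindex `k`:
`(‖k‖^{‖k‖}/k^k)·|q|^{#k}·|z^k|`. -/
noncomputable def DeltaTerm (q : ℂ) (z : ℕ → ℂ) (k : ℕ →₀ ℕ) : ℝ :=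
  (nn k / kk k) * ‖q‖ ^ k.support.card * ∏ ν ∈ k.support, ‖z ν‖ ^ k ν

/-- `Δ(q,z) = ∑_k (‖k‖^{‖k‖}/k^k)·|q|^{#k}·|z^k|`. -/
noncomputable def Delta (q : ℂ) (z : ℕ → ℂ) : ℝ := ∑' k, DeltaTerm q z k


section part1
open Metric Filter Topology

lemma aux_one_var {g : ℂ → ℂ} {ρ C : ℝ} (hρ : 0 < ρ) (hd : DifferentiableOn ℂ g (ball 0 ρ))
    (hC : ∀ ζ ∈ ball (0 : ℂ) ρ, ‖g ζ‖ ≤ C) :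
    ‖deriv g 0‖ ≤ 2 * C / ρ ∧
    ∀ ζ ∈ ball (0 : ℂ) ρ, ‖g ζ - g 0 - deriv g 0 * ζ‖ ≤ 4 * C / ρ ^ 2 * ‖ζ‖ ^ 2 := by
  have h0 : (0 : ℂ) ∈ ball (0 : ℂ) ρ := by simpa using hρ
  have hb : ∀ ζ ∈ ball (0 : ℂ) ρ, ‖dslope g 0 ζ‖ ≤ 2 * C / ρ := by
    intro ζ hζ
    refine Complex.norm_dslope_le_div_of_mapsTo_ball hd ?_ hζ
    intro w hw
    rw [mem_closedBall, dist_eq_norm]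
    refine (norm_sub_le _ _).trans ?_
    linarith [hC w hw, hC 0 h0]
  have hd2 : DifferentiableOn ℂ (dslope g 0) (ball 0 ρ) :=
    (Complex.differentiableOn_dslope (ball_mem_nhds 0 hρ)).2 hd
  have hb2 : ∀ ζ ∈ ball (0 : ℂ) ρ, ‖dslope (dslope g 0) 0 ζ‖ ≤ (4 * C / ρ) / ρ := by
    intro ζ hζ
    refine Complex.norm_dslope_le_div_of_mapsTo_ball hd2 ?_ hζ
    intro w hw
    rw [mem_closedBall, dist_eq_norm]
    refine (norm_sub_le _ _).trans ?_
    have e : 4 * C / ρ = 2 * C / ρ + 2 * C / ρ := by ring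
    linarith [hb w hw, hb 0 h0]
  refine ⟨by simpa using hb 0 h0, fun ζ hζ => ?_⟩
  have e1 : g ζ - g 0 = ζ * dslope g 0 ζ := by
    have := sub_smul_dslope g 0 ζ
    simpa using this.symm
  have e2 : dslope g 0 ζ - deriv g 0 = ζ * dslope (dslope g 0) 0 ζ := by
    have := sub_smul_dslope (dslope g 0) 0 ζ
    simpa using this.symm
  have e3 : g ζ - g 0 - deriv g 0 * ζ = ζ * ζ * dslope (dslope g 0) 0 ζ := by
    rw [e1]
    linear_combination ζ * e2
  rw [e3, norm_mul, norm_mul]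
  have := hb2 ζ hζ
  calc ‖ζ‖ * ‖ζ‖ * ‖dslope (dslope g 0) 0 ζ‖ ≤ ‖ζ‖ * ‖ζ‖ * ((4 * C / ρ) / ρ) := by gcongr
    _ = _ := by field_simp

lemma aux_fderiv {E : Type*} [NormedAddCommGroup E] [NormedSpace ℂ E] {f : E → ℂ} {z : E}
    {ρ C : ℝ} (hρ : 0 < ρ) (hd : DifferentiableOn ℂ f (ball z ρ))
    (hC : ∀ w ∈ ball z ρ, ‖f w‖ ≤ C) (v : E) :
    ‖fderiv ℂ f z v‖ ≤ 2 * C / ρ * ‖v‖ ∧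
    (‖v‖ < ρ → ‖f (z + v) - f z - fderiv ℂ f z v‖ ≤ 4 * C / ρ ^ 2 * ‖v‖ ^ 2) := by
  rcases eq_or_ne v 0 with rfl | hv
  · simp
  have hv' : 0 < ‖v‖ := norm_pos_iff.2 hv
  set u : E := ((‖v‖⁻¹ : ℝ) : ℂ) • v with hu
  have hun : ‖u‖ = 1 := by
    rw [hu, norm_smul, Complex.norm_real, norm_inv, norm_norm, inv_mul_cancel₀ hv'.ne']
  have hvu : v = ((‖v‖ : ℝ) : ℂ) • u := by
    rw [hu, smul_smul, ← Complex.ofReal_mul, mul_inv_cancel₀ hv'.ne']; simp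
  have hm : ∀ ζ ∈ ball (0 : ℂ) ρ, z + ζ • u ∈ ball z ρ := by
    intro ζ hζ
    simpa [mem_ball, dist_eq_norm, norm_smul, hun] using hζ
  have hline : ∀ ζ : ℂ, DifferentiableAt ℂ (fun ζ : ℂ => z + ζ • u) ζ := by
    intro ζ; fun_prop
  have hfa : ∀ w ∈ ball z ρ, DifferentiableAt ℂ f w := fun w hw =>
    (hd w hw).differentiableAt (isOpen_ball.mem_nhds hw)
  have key := aux_one_var (g := fun ζ => f (z + ζ • u)) (C := C) hρ
    (fun ζ hζ => (DifferentiableAt.comp ζ (hfa _ (hm ζ hζ)) (hline ζ)).differentiableWithinAt)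
    (fun ζ hζ => hC _ (hm ζ hζ))
  have hder : deriv (fun ζ : ℂ => f (z + ζ • u)) 0 = fderiv ℂ f z u := by
    have h1 : HasDerivAt (fun ζ : ℂ => z + ζ • u) u 0 := by
      simpa using ((hasDerivAt_id (0:ℂ)).smul_const u).const_add z
    have h2 : HasFDerivAt f (fderiv ℂ f z) (z + (0:ℂ) • u) := by
      simpa using (hfa z (mem_ball_self hρ)).hasFDerivAt
    exact (h2.comp_hasDerivAt (0:ℂ) h1).deriv
  rw [hder] at key
  have hfv : fderiv ℂ f z v = ((‖v‖ : ℝ) : ℂ) * fderiv ℂ f z u := by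
    conv_lhs => rw [hvu]
    rw [map_smul, smul_eq_mul]
  constructor
  · rw [hfv, norm_mul, Complex.norm_real, norm_norm, mul_comm]
    gcongr
    exact key.1
  · intro hlt
    have := key.2 ((‖v‖ : ℝ) : ℂ) (by simpa using hlt)
    simp only [← hvu, zero_smul, add_zero, Complex.norm_real, norm_norm] at this
    rwa [hfv, mul_comm]

lemma aux_diff {E ι : Type*} [NormedAddCommGroup E] [NormedSpace ℂ E] {f : ι → E → ℂ} {z : E}
    {ρ C : ℝ} (hρ : 0 < ρ) (hd : ∀ i, Differentiable ℂ (f i))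
    (hC : ∀ w ∈ ball z ρ, ∀ F : Finset ι, ∑ i ∈ F, ‖f i w‖ ≤ C) :
    DifferentiableAt ℂ (fun w => ∑' i, f i w) z := by
  have hsum : ∀ w ∈ ball z ρ, Summable fun i => f i w := fun w hw =>
    Summable.of_norm (summable_of_sum_le (fun _ => norm_nonneg _) (hC w hw))
  have hDs : ∀ v (F : Finset ι), ∑ i ∈ F, ‖fderiv ℂ (f i) z v‖ ≤ 2 * C / ρ * ‖v‖ := by
    intro v F
    -- phases
    have hph : ∀ i, ∃ θ : ℂ, ‖θ‖ ≤ 1 ∧ θ * fderiv ℂ (f i) z v = (‖fderiv ℂ (f i) z v‖ : ℂ) := by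
      intro i
      set d := fderiv ℂ (f i) z v
      rcases eq_or_ne d 0 with h | h
      · exact ⟨0, by simp, by simp [h]⟩
      · refine ⟨(‖d‖ : ℂ) / d, by simp [norm_ne_zero_iff.2 h], by field_simp⟩
    choose θ hθ1 hθ2 using hph
    have hdS : Differentiable ℂ (fun w => ∑ i ∈ F, θ i * f i w) := by
      have := hd
      fun_prop
    have h := (aux_fderiv (f := fun w => ∑ i ∈ F, θ i * f i w) (z := z) (C := C) hρ
      hdS.differentiableOn (fun w hw => by
        refine (norm_sum_le _ _).trans (le_trans (Finset.sum_le_sum fun i _ => ?_) (hC w hw F))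
        rw [norm_mul]
        exact mul_le_of_le_one_left (norm_nonneg _) (hθ1 i)) v).1
    have e : fderiv ℂ (fun w => ∑ i ∈ F, θ i * f i w) z v
        = ((∑ i ∈ F, ‖fderiv ℂ (f i) z v‖ : ℝ) : ℂ) := by
      rw [fderiv_fun_sum (fun i _ => ((hd i z).const_mul (θ i)))]
      rw [sum_apply, Complex.ofReal_sum]
      refine Finset.sum_congr rfl fun i _ => ?_
      rw [fderiv_const_mul (hd i z), smul_apply, smul_eq_mul, hθ2]
    rw [e, Complex.norm_real, Real.norm_of_nonneg (Finset.sum_nonneg fun _ _ => norm_nonneg _)] at h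
    exact h
  have hDsum : ∀ v, Summable fun i => fderiv ℂ (f i) z v := fun v =>
    Summable.of_norm (summable_of_sum_le (fun _ => norm_nonneg _) (hDs v))
  let D0 : E →ₗ[ℂ] ℂ :=
    { toFun := fun v => ∑' i, fderiv ℂ (f i) z v
      map_add' := fun v w => by
        simp only [map_add]
        exact (hDsum v).tsum_add (hDsum w)
      map_smul' := fun c v => by
        simp only [map_smul, smul_eq_mul, RingHom.id_apply]
        exact tsum_mul_left }
  have hD0 : ∀ v, ‖D0 v‖ ≤ 2 * C / ρ * ‖v‖ := fun v => by
    refine le_of_tendsto (hDsum v).hasSum.norm (Eventually.of_forall fun F => ?_)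
    exact (norm_sum_le _ _).trans (hDs v F)
  let D : E →L[ℂ] ℂ := D0.mkContinuous _ hD0
  have hrem : ∀ v, ‖v‖ < ρ →
      ‖(∑' i, f i (z + v)) - (∑' i, f i z) - D v‖ ≤ 4 * C / ρ ^ 2 * ‖v‖ ^ 2 := by
    intro v hv
    have h1 := (hsum (z + v) (by simpa [mem_ball, dist_eq_norm] using hv)).hasSum
    have h2 := (hsum z (mem_ball_self hρ)).hasSum
    have h3 := (hDsum v).hasSum
    refine le_of_tendsto ((h1.sub h2).sub h3).norm (Eventually.of_forall fun F => ?_)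
    have hdS : Differentiable ℂ (fun w => ∑ i ∈ F, f i w) := by
      have := hd
      fun_prop
    have h := (aux_fderiv (f := fun w => ∑ i ∈ F, f i w) (z := z) (C := C) hρ
      hdS.differentiableOn (fun w hw => (norm_sum_le _ _).trans (hC w hw F)) v).2 hv
    rw [fderiv_fun_sum (fun i _ => hd i z), sum_apply] at h
    simpa [Finset.sum_sub_distrib] using h
  refine HasFDerivAt.differentiableAt (f' := D) ?_
  rw [hasFDerivAt_iff_isLittleO_nhds_zero]
  have hO : (fun v => (∑' i, f i (z + v)) - (∑' i, f i z) - D v) =O[𝓝 0]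
      fun v : E => ‖v‖ ^ 2 := by
    refine Asymptotics.IsBigO.of_bound (4 * C / ρ ^ 2) ?_
    filter_upwards [ball_mem_nhds (0 : E) hρ] with v hv
    rw [norm_pow, norm_norm]
    exact hrem v (by simpa using hv)
  exact hO.trans_isLittleO (Asymptotics.isLittleO_norm_pow_id one_lt_two)

end part1

section part2
open Metric Filter Topology

lemma l1_hasSum (z : L1) : HasSum (fun ν => ‖z ν‖) ‖z‖ := by
  have := lp.hasSum_norm (p := 1) (by simp) z
  simpa using this

lemma l1_mem {f : ℕ → ℂ} (hf : Summable fun ν => ‖f ν‖) : Memℓp f 1 :=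
  memℓp_gen (by simpa using hf)

lemma l1_norm_le {z : L1} {g : ℕ → ℝ} {s : ℝ} (hg : HasSum g s) (h : ∀ ν, ‖z ν‖ ≤ g ν) : ‖z‖ ≤ s :=
  hasSum_le h (l1_hasSum z) hg

lemma diag_exists (M : ℕ → ℝ) (B : ℝ) (hM : ∀ ν, |M ν| ≤ B) :
    ∃ T : L1 →L[ℂ] L1, (∀ x ν, T x ν = (M ν : ℂ) * x ν) ∧ ‖T‖ ≤ B := by
  have hB : 0 ≤ B := (abs_nonneg _).trans (hM 0)
  have hle : ∀ (x : L1) ν, ‖(M ν : ℂ) * x ν‖ ≤ B * ‖x ν‖ := fun x ν => by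
    rw [norm_mul, Complex.norm_real, Real.norm_eq_abs]
    gcongr
    exact hM ν
  let T0 : L1 →ₗ[ℂ] L1 :=
    { toFun := fun x => ⟨fun ν => (M ν : ℂ) * x ν, l1_mem
        (Summable.of_nonneg_of_le (fun _ => norm_nonneg _) (hle x)
          ((l1_hasSum x).summable.mul_left B))⟩
      map_add' := fun x y => by
        ext ν
        exact mul_add _ _ _
      map_smul' := fun c x => by
        ext ν
        exact mul_left_comm _ _ _ }
  have hT0 : ∀ x ν, T0 x ν = (M ν : ℂ) * x ν := fun x ν => rfl
  have hb : ∀ x, ‖T0 x‖ ≤ B * ‖x‖ := fun x =>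
    l1_norm_le ((l1_hasSum x).mul_left B) (hle x)
  exact ⟨T0.mkContinuous B hb, hT0, LinearMap.mkContinuous_norm_le _ hB _⟩

lemma diag_compact (M : ℕ → ℝ) (hM : Tendsto M atTop (𝓝 0)) (T : L1 →L[ℂ] L1)
    (hT : ∀ x ν, T x ν = (M ν : ℂ) * x ν) : IsCompactOperator T := by
  let F : ℕ → L1 →L[ℂ] L1 := fun N => ∑ i ∈ Finset.range N,
    (M i : ℂ) • (lp.singleContinuousLinearMap ℂ (fun _ : ℕ => ℂ) 1 i ∘L lp.evalCLM ℂ (fun _ : ℕ => ℂ) 1 i)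
  have hF : ∀ N x ν, F N x ν = if ν < N then (M ν : ℂ) * x ν else 0 := by
    intro N x ν
    have e : F N x = ∑ i ∈ Finset.range N, (M i : ℂ) • lp.single 1 i (x i) := by
      simp only [F, sum_apply]
      rfl
    rw [e, lp.coeFn_sum, Finset.sum_apply]
    have h1 : ∀ i, ((M i : ℂ) • lp.single 1 i (x i) : L1) ν = if ν = i then (M i : ℂ) * x i else 0 := by
      intro i
      rw [lp.coeFn_smul, Pi.smul_apply, lp.single_apply, Pi.single_apply]
      split_ifs with h
      · subst h; rfl
      · simp
    rw [Finset.sum_congr rfl fun i _ => h1 i]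
    simp
  have hFc : ∀ N, IsCompactOperator (F N) := by
    intro N
    have : F N ∈ compactOperator (RingHom.id ℂ) L1 L1 := by
      refine Submodule.sum_mem _ fun i _ => Submodule.smul_mem _ _ ?_
      exact (isCompactOperator_of_locallyCompactSpace_rng
        (lp.singleContinuousLinearMap ℂ (fun _ : ℕ => ℂ) 1 i)).comp_clm _
    exact this
  refine isCompactOperator_of_tendsto (l := atTop) (F := F) ?_ (Eventually.of_forall hFc)
  rw [Metric.tendsto_atTop]
  intro e he
  obtain ⟨N, hN⟩ := Metric.tendsto_atTop.1 hM (e / 2) (by positivity)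
  refine ⟨N, fun n hn => ?_⟩
  rw [dist_eq_norm]
  refine lt_of_le_of_lt (ContinuousLinearMap.opNorm_le_bound _ (by positivity : 0 ≤ e / 2) fun x => ?_)
    (by linarith)
  refine l1_norm_le ((l1_hasSum x).mul_left (e / 2)) fun ν => ?_
  have : (F n - T) x ν = F n x ν - T x ν := rfl
  rw [this, hF, hT]
  split_ifs with h
  · simp; positivity
  · have := hN ν (by omega)
    rw [dist_zero_right] at this
    rw [zero_sub, norm_neg, norm_mul, Complex.norm_real]
    gcongr

lemma local_bound {R s : ℝ} (hs : 0 < s) (hsR : s < R) (φ : L1 → ℂ)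
    (hol : DifferentiableOn ℂ φ {z : L1 | ‖z‖ < R}) (μ : ℕ → ℝ) (hμ0 : ∀ ν, 0 < μ ν)
    (hμ1 : ∀ ν, μ ν ≤ 1) (hμ : Tendsto μ atTop (𝓝 0)) :
    ∃ η : ℝ, 0 < η ∧ η ≤ 1 ∧ ∃ C : ℝ, 0 < C ∧ ∀ w w' : L1, ‖w'‖ ≤ s →
      (∀ ν, w ν = ((max (μ ν) η : ℝ) : ℂ) * w' ν) → ‖φ w‖ ≤ C := by
  obtain ⟨T, hT, hTn⟩ := diag_exists μ 1 fun ν => by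
    rw [abs_of_pos (hμ0 ν)]; exact hμ1 ν
  set L := closure (T '' closedBall 0 s) with hL
  have hLc : IsCompact L :=
    (diag_compact μ hμ T hT).isCompact_closure_image_closedBall (f := (T : L1 →ₗ[ℂ] L1)) s
  have hLs : L ⊆ {z : L1 | ‖z‖ < R} := by
    have : L ⊆ closedBall 0 s := by
      refine closure_minimal ?_ isClosed_closedBall
      rintro _ ⟨x, hx, rfl⟩
      rw [mem_closedBall_zero_iff] at hx ⊢
      refine (T.le_opNorm x).trans ?_
      nlinarith [norm_nonneg x, norm_nonneg T]
    intro z hz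
    have := this hz
    rw [mem_closedBall_zero_iff] at this
    exact this.trans_lt hsR
  have hop : IsOpen {z : L1 | ‖z‖ < R} := isOpen_lt continuous_norm continuous_const
  obtain ⟨C, hC⟩ := hLc.exists_bound_of_continuousOn (hol.continuousOn.mono hLs)
  set U : Set L1 := {z : L1 | ‖z‖ < R} ∩ (fun z => ‖φ z‖) ⁻¹' (Iio (|C| + 1)) with hU
  have hUo : IsOpen U := hol.continuousOn.norm.isOpen_inter_preimage hop isOpen_Iio
  have hLU : L ⊆ U := fun z hz => ⟨hLs hz, by
    have := hC z hz
    have h2 := le_abs_self C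
    simp only [mem_preimage, mem_Iio]; linarith⟩
  obtain ⟨δ, hδ, hδU⟩ := hLc.exists_thickening_subset_open hUo hLU
  refine ⟨min 1 (δ / (2 * s)), by positivity, min_le_left _ _, |C| + 1, by positivity, ?_⟩
  intro w w' hw' hw
  set η := min 1 (δ / (2 * s)) with hη
  have hη0 : 0 < η := by positivity
  have hmem : w ∈ thickening δ L := by
    rw [mem_thickening_iff]
    refine ⟨T w', subset_closure ⟨w', by simpa using hw', rfl⟩, ?_⟩
    rw [dist_eq_norm]
    have h1 : ‖w - T w'‖ ≤ η * ‖w'‖ := by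
      refine l1_norm_le ((l1_hasSum w').mul_left η) fun ν => ?_
      have : (w - T w') ν = w ν - T w' ν := rfl
      rw [this, hw, hT, ← sub_mul, ← Complex.ofReal_sub, norm_mul, Complex.norm_real, Real.norm_eq_abs]
      gcongr
      rw [abs_of_nonneg (sub_nonneg.2 (le_max_left _ _))]
      rcases max_cases (μ ν) η with h | h <;> linarith [hμ0 ν]
    have h2 : η * ‖w'‖ ≤ δ / (2 * s) * s := by
      gcongr
      exact min_le_right _ _
    have h3 : δ / (2 * s) * s = δ / 2 := by field_simp
    linarith
  exact le_of_lt (hδU hmem).2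

end part2

section part3
open Metric Filter Topology MeasureTheory

lemma integral_fourier1 (n : ℤ) :
    ∫ x : AddCircle (1 : ℝ), fourier n x ∂AddCircle.haarAddCircle = if n = 0 then 1 else 0 := by
  split_ifs with h
  · subst h; simp
  · exact integral_eq_zero_of_add_right_eq_neg (μ := AddCircle.haarAddCircle)
      (fourier_add_half_inv_index h one_pos)

lemma cauchy_est {R : ℝ} (φ : L1 → ℂ) (a : (ℕ →₀ ℕ) → ℂ)
    (ha : ∀ z : L1, ‖z‖ < R → {ν : ℕ | z ν ≠ 0}.Finite →
      Summable (fun k => ‖a k * monom k (fun ν => z ν)‖) ∧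
      HasSum (fun k => a k * monom k (fun ν => z ν)) (φ z))
    (k : ℕ →₀ ℕ) (y : ℕ → ℝ) (hy0 : ∀ ν, 0 ≤ y ν) (hys : ∀ ν, ν ∉ k.support → y ν = 0)
    (hyR : ∑ ν ∈ k.support, y ν < R) (C : ℝ)
    (hC : ∀ w : L1, (∀ ν, ‖w ν‖ ≤ y ν) → ‖φ w‖ ≤ C) :
    ‖a k‖ * ∏ ν ∈ k.support, y ν ^ k ν ≤ C := by
  classical
  set F := k.support with hF
  have hysum : HasSum y (∑ ν ∈ F, y ν) := hasSum_sum_of_ne_finset_zero hys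
  let Y0 : (F → AddCircle (1 : ℝ)) → ℕ → ℂ := fun x ν =>
    if h : ν ∈ F then (y ν : ℂ) * fourier 1 (x ⟨ν, h⟩) else 0
  have hf1 : ∀ (n : ℤ) (x : AddCircle (1 : ℝ)), ‖fourier n x‖ = 1 := fun n x => Circle.norm_coe _
  have hY0n : ∀ x ν, ‖Y0 x ν‖ = y ν := by
    intro x ν
    by_cases h : ν ∈ F
    · simp only [Y0, h, dif_pos, norm_mul, hf1, Complex.norm_real, mul_one]
      exact Real.norm_of_nonneg (hy0 ν)
    · simp only [Y0, h, dif_neg, not_false_eq_true, norm_zero, hys ν h]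
  let Y : (F → AddCircle (1 : ℝ)) → L1 := fun x => ⟨Y0 x, l1_mem (by
    simp_rw [hY0n]; exact hysum.summable)⟩
  have hYv : ∀ x ν, Y x ν = Y0 x ν := fun x ν => rfl
  have hYn : ∀ x, ‖Y x‖ < R := fun x =>
    (l1_norm_le hysum fun ν => (hY0n x ν).le).trans_lt hyR
  have hYf : ∀ x, {ν : ℕ | Y x ν ≠ 0}.Finite := fun x =>
    F.finite_toSet.subset fun ν hν => by
      by_contra h
      exact hν (by rw [hYv]; exact dif_neg (by simpa using h))
  let c : (ℕ →₀ ℕ) → ℝ := fun j => if j.support ⊆ F then ∏ ν ∈ F, y ν ^ j ν else 0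
  have hc0 : ∀ j, 0 ≤ c j := fun j => by
    simp only [c]; split_ifs
    · exact Finset.prod_nonneg fun ν _ => pow_nonneg (hy0 ν) _
    · exact le_rfl
  have hmon : ∀ j x, monom j (fun ν => Y x ν) = (c j : ℂ) * ∏ i : F, fourier (j i : ℤ) (x i) := by
    intro j x
    by_cases h : j.support ⊆ F
    · simp only [c, if_pos h, monom]
      rw [Finset.prod_subset h (fun ν _ hν => by
        rw [Finsupp.notMem_support_iff.1 hν, pow_zero])]
      rw [← Finset.prod_coe_sort F, ← Finset.prod_coe_sort F, Complex.ofReal_prod,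
        ← Finset.prod_mul_distrib]
      refine Finset.prod_congr rfl fun i _ => ?_
      have : Y x i = (y i : ℂ) * fourier 1 (x i) := by
        rw [hYv]; simp only [Y0]; rw [dif_pos i.2]
      rw [this, mul_pow, Complex.ofReal_pow]
      congr 1
      simp [fourier_apply, AddCircle.toCircle_nsmul]
    · simp only [c, if_neg h, monom]
      obtain ⟨ν, hν, hνF⟩ := Finset.not_subset.1 h
      rw [Finset.prod_eq_zero hν]
      · simp
      · have : Y x ν = 0 := by rw [hYv]; simp only [Y0]; rw [dif_neg hνF]
        rw [this]
        exact zero_pow (Finsupp.mem_support_iff.1 hν)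
  have hmonn : ∀ j x, ‖monom j (fun ν => Y x ν)‖ = c j := by
    intro j x
    rw [hmon, norm_mul, norm_prod]
    simp only [hf1, Finset.prod_const_one, mul_one, Complex.norm_real]
    exact Real.norm_of_nonneg (hc0 j)
  let G : (F → AddCircle (1 : ℝ)) → ℂ := fun x => ∏ i : F, fourier (-(k i : ℤ)) (x i)
  have hGn : ∀ x, ‖G x‖ = 1 := fun x => by
    simp only [G, norm_prod, hf1, Finset.prod_const_one]
  let P : Measure (F → AddCircle (1 : ℝ)) := Measure.pi fun _ => AddCircle.haarAddCircle
  let f : (ℕ →₀ ℕ) → (F → AddCircle (1 : ℝ)) → ℂ := fun j x =>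
    (a j * monom j (fun ν => Y x ν)) * G x
  have hfe : ∀ j x, f j x = (a j * c j) * ∏ i : F, fourier ((j i : ℤ) - k i) (x i) := by
    intro j x
    simp only [f, G, hmon]
    rw [mul_assoc, mul_assoc, mul_assoc, ← Finset.prod_mul_distrib]
    congr 2
    refine Finset.prod_congr rfl fun i _ => ?_
    rw [sub_eq_add_neg, fourier_add]
  have hfn : ∀ j x, ‖f j x‖ = ‖a j‖ * c j := by
    intro j x
    simp only [f, norm_mul, hGn, hmonn, mul_one]
  have hsumc : Summable fun j => ‖a j‖ * c j := by
    have := (ha (Y 0) (hYn 0) (hYf 0)).1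
    simpa only [norm_mul, hmonn] using this
  have hfcont : ∀ j, Continuous (f j) := by
    intro j
    have : f j = fun x => (a j * c j) * ∏ i : F, fourier ((j i : ℤ) - k i) (x i) := funext (hfe j)
    rw [this]
    fun_prop
  have hint : ∀ j, Integrable (f j) P := fun j =>
    Integrable.of_bound (hfcont j).aestronglyMeasurable (‖a j‖ * c j)
      (Eventually.of_forall fun x => (hfn j x).le)
  have hI : ∀ j, ∫ x, f j x ∂P = if j = k then a k * c k else 0 := by
    intro j
    simp_rw [hfe]
    rw [integral_const_mul]
    have e : ∫ x, ∏ i : F, fourier ((j i : ℤ) - k i) (x i) ∂P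
        = ∏ i : F, ∫ t : AddCircle (1 : ℝ), fourier ((j i : ℤ) - k i) t ∂AddCircle.haarAddCircle :=
      integral_fintype_prod_eq_prod (fun (i : F) (t : AddCircle (1 : ℝ)) =>
        (fourier ((j i : ℤ) - k i) t : ℂ))
    rw [e]
    simp_rw [integral_fourier1]
    split_ifs with h
    · subst h; simp
    · by_cases hs : j.support ⊆ F
      · have : ∃ i ∈ F, j i ≠ k i := by
          by_contra! hcon
          apply h
          ext ν
          by_cases hν : ν ∈ F
          · exact hcon ν hν
          · rw [Finsupp.notMem_support_iff.1 hν, Finsupp.notMem_support_iff.1 fun h' => hν (hs h')]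
        obtain ⟨i, hi, hne⟩ := this
        rw [Finset.prod_eq_zero (Finset.mem_univ (⟨i, hi⟩ : F)), mul_zero]
        rw [if_neg]
        simp only
        omega
      · simp [c, if_neg hs]
  have hS := hasSum_integral_of_summable_integral_norm hint (by
    simp_rw [hfn]
    simpa [P] using hsumc)
  simp_rw [hI] at hS
  have hval := hS.unique (hasSum_ite_eq k (a k * c k))
  have hts : ∀ x, ∑' j, f j x = φ (Y x) * G x := fun x =>
    ((ha (Y x) (hYn x) (hYf x)).2.mul_right (G x)).tsum_eq
  have hbd : ‖∫ x, ∑' j, f j x ∂P‖ ≤ C * P.real univ :=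
    norm_integral_le_of_norm_le_const (Eventually.of_forall fun x => by
      rw [hts, norm_mul, hGn, mul_one]
      exact hC _ fun ν => (hY0n x ν).le)
  rw [hval] at hbd
  have hck : c k = ∏ ν ∈ F, y ν ^ k ν := if_pos (Finset.Subset.refl _)
  rw [norm_mul, Complex.norm_real, Real.norm_of_nonneg (hc0 k), hck] at hbd
  simpa [P] using hbd

end part3

section part4
open Metric Filter Topology

lemma knormN_eq {k : ℕ →₀ ℕ} {S : Finset ℕ} (h : k.support ⊆ S) : knormN k = ∑ ν ∈ S, k ν := by
  unfold knormN
  exact Finsupp.sum_of_support_subset k h _ (fun _ _ => rfl)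

lemma kk_pos (k : ℕ →₀ ℕ) : 0 < kk k := Finset.prod_pos fun ν hν => by
  have : 0 < k ν := Nat.pos_of_ne_zero (Finsupp.mem_support_iff.1 hν)
  positivity

lemma nn_pos (k : ℕ →₀ ℕ) : 0 < nn k := by
  unfold nn
  rcases Nat.eq_zero_or_pos (knormN k) with h | h
  · rw [h]; simp
  · positivity

lemma nn_div_kk_le {k : ℕ →₀ ℕ} {S : Finset ℕ} (h : k.support ⊆ S) :
    nn k / kk k ≤ Real.exp 1 ^ knormN k * (Nat.multinomial S k : ℝ) := by
  have hm : (∏ i ∈ S, ((k i).factorial : ℝ)) * (Nat.multinomial S k : ℝ)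
      = ((knormN k).factorial : ℝ) := by
    rw [knormN_eq h]
    exact_mod_cast Nat.multinomial_spec S k
  have h1 : nn k ≤ Real.exp 1 ^ knormN k * ((knormN k).factorial : ℝ) := by
    have := Real.pow_div_factorial_le_exp (x := (knormN k : ℝ)) (by positivity) (knormN k)
    rw [div_le_iff₀ (by positivity)] at this
    unfold nn
    rwa [← Real.exp_nat_mul, mul_one]
  have h2 : (∏ i ∈ S, ((k i).factorial : ℝ)) ≤ kk k := by
    have : kk k = ∏ i ∈ S, (k i : ℝ) ^ k i := by
      unfold kk
      exact Finset.prod_subset h fun ν _ hν => by rw [Finsupp.notMem_support_iff.1 hν, pow_zero]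
    rw [this]
    refine Finset.prod_le_prod (fun _ _ => by positivity) fun i _ => ?_
    exact_mod_cast Nat.factorial_le_pow (k i)
  rw [div_le_iff₀ (kk_pos k)]
  calc nn k ≤ Real.exp 1 ^ knormN k * ((knormN k).factorial : ℝ) := h1
    _ = Real.exp 1 ^ knormN k * (Nat.multinomial S k : ℝ) * (∏ i ∈ S, ((k i).factorial : ℝ)) := by
      rw [← hm]; ring
    _ ≤ _ := by gcongr

lemma sum_bound (x : ℕ → ℝ) (hx : ∀ ν, 0 ≤ x ν) (X t : ℝ) (hX : ∀ S : Finset ℕ, ∑ ν ∈ S, x ν ≤ X)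
    (ht : 0 ≤ t) (htX : Real.exp 1 * t * X ≤ 1 / 2) (F : Finset (ℕ →₀ ℕ)) :
    ∑ k ∈ F, nn k / kk k * t ^ knormN k * ∏ ν ∈ k.support, x ν ^ k ν ≤ 2 := by
  classical
  set S := F.biUnion fun k => k.support with hS
  have hsub : ∀ k ∈ F, k.support ⊆ S := fun k hk => Finset.subset_biUnion_of_mem _ hk
  set N := (F.sup knormN) + 1 with hN
  have hmaps : ∀ k ∈ F, knormN k ∈ Finset.range N := fun k hk => by
    rw [Finset.mem_range, hN]
    exact Nat.lt_succ_of_le (Finset.le_sup hk)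
  rw [← Finset.sum_fiberwise_of_maps_to hmaps]
  have hX0 : 0 ≤ ∑ ν ∈ S, x ν := Finset.sum_nonneg fun ν _ => hx ν
  have hstep : ∀ n ∈ Finset.range N,
      ∑ k ∈ F with knormN k = n, nn k / kk k * t ^ knormN k * ∏ ν ∈ k.support, x ν ^ k ν
        ≤ (1 / 2) ^ n := by
    intro n _
    calc ∑ k ∈ F with knormN k = n, nn k / kk k * t ^ knormN k * ∏ ν ∈ k.support, x ν ^ k ν
        ≤ ∑ k ∈ F with knormN k = n, (Real.exp 1 * t) ^ n *
            ((Nat.multinomial S k : ℝ) * ∏ ν ∈ S, x ν ^ k ν) := by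
          refine Finset.sum_le_sum fun k hk => ?_
          obtain ⟨hkF, hkn⟩ := Finset.mem_filter.1 hk
          have e : ∏ ν ∈ k.support, x ν ^ k ν = ∏ ν ∈ S, x ν ^ k ν :=
            Finset.prod_subset (hsub k hkF) fun ν _ hν => by
              rw [Finsupp.notMem_support_iff.1 hν, pow_zero]
          have hp : 0 ≤ ∏ ν ∈ S, x ν ^ k ν := Finset.prod_nonneg fun ν _ => pow_nonneg (hx ν) _
          have := nn_div_kk_le (hsub k hkF)
          rw [e]
          calc _ ≤ Real.exp 1 ^ knormN k * (Nat.multinomial S k : ℝ) * t ^ knormN k *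
                ∏ ν ∈ S, x ν ^ k ν := by gcongr
            _ = _ := by rw [hkn, mul_pow]; ring
      _ = (Real.exp 1 * t) ^ n * ∑ k ∈ F with knormN k = n,
            ((Nat.multinomial S k : ℝ) * ∏ ν ∈ S, x ν ^ k ν) := by rw [Finset.mul_sum]
      _ ≤ (Real.exp 1 * t) ^ n * (∑ ν ∈ S, x ν) ^ n := by
          gcongr
          rw [Finset.sum_pow_eq_sum_piAntidiag]
          rw [← Finset.sum_image (s := {k ∈ F | knormN k = n}) (g := fun k : ℕ →₀ ℕ => (k : ℕ → ℕ))
            (f := fun k : ℕ → ℕ => ((Nat.multinomial S k : ℝ) * ∏ ν ∈ S, x ν ^ k ν))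
            (fun k _ l _ h => DFunLike.coe_injective h)]
          refine Finset.sum_le_sum_of_subset_of_nonneg ?_ fun k _ _ => ?_
          · intro f hf
            obtain ⟨k, hk, rfl⟩ := Finset.mem_image.1 hf
            obtain ⟨hkF, hkn⟩ := Finset.mem_filter.1 hk
            rw [Finset.mem_piAntidiag]
            refine ⟨by rw [← hkn, knormN_eq (hsub k hkF)], fun i hi => ?_⟩
            exact hsub k hkF (Finsupp.mem_support_iff.2 hi)
          · exact mul_nonneg (by positivity) (Finset.prod_nonneg fun ν _ => pow_nonneg (hx ν) _)
      _ = (Real.exp 1 * t * ∑ ν ∈ S, x ν) ^ n := by rw [← mul_pow]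
      _ ≤ (1 / 2) ^ n := by
          gcongr
          refine le_trans ?_ htX
          gcongr
          exact hX S
  refine (Finset.sum_le_sum hstep).trans ?_
  have := sum_le_hasSum (Finset.range N) (fun _ _ => by positivity) hasSum_geometric_two
  simpa using this

lemma exists_lambda (b : ℕ → ℝ) (hb : ∀ ν, 0 ≤ b ν) (hs : Summable b) :
    ∃ l : ℕ → ℝ, (∀ ν, 0 < l ν) ∧ (∀ ν, l ν ≤ 1) ∧ Tendsto l atTop (𝓝 0) ∧
      Summable fun ν => b ν / l ν := by
  set c : ℕ → ℝ := fun ν => b ν + (1 / 2) ^ ν with hc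
  have hcs : Summable c := hs.add summable_geometric_two
  have hcp : ∀ ν, 0 < c ν := fun ν => by have := hb ν; positivity
  set T : ℕ → ℝ := fun ν => ∑' i, c (i + ν) with hT
  have hTs : ∀ ν, Summable fun i => c (i + ν) := fun ν => (summable_nat_add_iff ν).2 hcs
  have hTp : ∀ ν, 0 < T ν := fun ν => (hTs ν).tsum_pos (fun i => (hcp _).le) 0 (hcp _)
  have hrec : ∀ ν, T ν = c ν + T (ν + 1) := fun ν => by
    simp only [hT]
    rw [(hTs ν).tsum_eq_zero_add]
    simp only [zero_add]
    congr 1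
    refine tsum_congr fun i => ?_
    congr 1; ring
  have hT0 : Tendsto T atTop (𝓝 0) := tendsto_sum_nat_add c
  set σ : ℕ → ℝ := fun ν => √(T ν) with hσ
  have hσp : ∀ ν, 0 < σ ν := fun ν => Real.sqrt_pos.2 (hTp ν)
  have hσq : ∀ ν, σ ν ^ 2 = T ν := fun ν => Real.sq_sqrt (hTp ν).le
  have hσa : Antitone σ := antitone_nat_of_succ_le fun ν =>
    Real.sqrt_le_sqrt (by have := hrec ν; have := hcp ν; linarith)
  have hσ0 : Tendsto σ atTop (𝓝 0) := by
    have := (Real.continuous_sqrt.tendsto 0).comp hT0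
    rw [Real.sqrt_zero] at this
    exact this
  refine ⟨fun ν => σ ν / σ 0, fun ν => div_pos (hσp ν) (hσp 0),
    fun ν => (div_le_one (hσp 0)).2 (hσa (Nat.zero_le ν)), by simpa using hσ0.div_const (σ 0), ?_⟩
  have hle : ∀ ν, b ν / (σ ν / σ 0) ≤ 2 * σ 0 * (σ ν - σ (ν + 1)) := by
    intro ν
    rw [div_div_eq_mul_div, div_le_iff₀ (hσp ν)]
    have h1 : b ν ≤ c ν := by simp only [hc]; have : (0:ℝ) < (1/2)^ν := by positivity
                              linarith
    have h2 : c ν ≤ 2 * σ ν * (σ ν - σ (ν + 1)) := by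
      have := hrec ν
      rw [← hσq, ← hσq] at this
      nlinarith [sq_nonneg (σ ν - σ (ν + 1))]
    calc b ν * σ 0 ≤ (2 * σ ν * (σ ν - σ (ν + 1))) * σ 0 := by
          have := hσp 0
          gcongr
          linarith
      _ = _ := by ring
  refine summable_of_sum_range_le (c := 2 * σ 0 * σ 0)
    (fun ν => div_nonneg (hb ν) (div_pos (hσp ν) (hσp 0)).le) fun n => ?_
  refine (Finset.sum_le_sum fun i _ => hle i).trans ?_
  rw [← Finset.mul_sum, Finset.sum_range_sub']
  have := hσp 0
  have := hσp n
  gcongr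
  linarith

end part4

section part5
open Metric Filter Topology

lemma coef_bound {R s : ℝ} (hs : 0 < s) (hsR : s < R) (φ : L1 → ℂ)
    (hol : DifferentiableOn ℂ φ {z : L1 | ‖z‖ < R}) (a : (ℕ →₀ ℕ) → ℂ)
    (ha : ∀ z : L1, ‖z‖ < R → {ν : ℕ | z ν ≠ 0}.Finite →
      Summable (fun k => ‖a k * monom k (fun ν => z ν)‖) ∧
      HasSum (fun k => a k * monom k (fun ν => z ν)) (φ z))
    (μ : ℕ → ℝ) (hμ0 : ∀ ν, 0 < μ ν)
    (hμ1 : ∀ ν, μ ν ≤ 1) (hμ : Tendsto μ atTop (𝓝 0)) :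
    ∃ η : ℝ, 0 < η ∧ η ≤ 1 ∧ ∃ C : ℝ, 0 < C ∧ ∀ k : ℕ →₀ ℕ,
      (‖a k‖ * kk k / nn k) * s ^ knormN k * ∏ ν ∈ k.support, max (μ ν) η ^ k ν ≤ C := by
  obtain ⟨η, hη0, hη1, C, hC0, hC⟩ := local_bound hs hsR φ hol μ hμ0 hμ1 hμ
  refine ⟨η, hη0, hη1, C, hC0, fun k => ?_⟩
  set M : ℕ → ℝ := fun ν => max (μ ν) η with hM
  have hM0 : ∀ ν, 0 < M ν := fun ν => lt_max_of_lt_right hη0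
  have hM1 : ∀ ν, M ν ≤ 1 := fun ν => max_le (hμ1 ν) hη1
  have hn : knormN k = ∑ ν ∈ k.support, k ν := knormN_eq (Finset.Subset.refl _)
  set q : ℕ → ℝ := fun ν => s * ((k ν : ℝ) / knormN k) with hq
  have hq0 : ∀ ν, 0 ≤ q ν := fun ν => by positivity
  have hqs : ∀ ν, ν ∉ k.support → q ν = 0 := fun ν hν => by
    simp [hq, Finsupp.notMem_support_iff.1 hν]
  have hqsum : ∑ ν ∈ k.support, q ν ≤ s := by
    simp only [hq]
    rw [← Finset.mul_sum, ← Finset.sum_div, ← Nat.cast_sum, ← hn]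
    exact mul_le_of_le_one_right hs.le (div_self_le_one _)
  have hqh : HasSum q (∑ ν ∈ k.support, q ν) := hasSum_sum_of_ne_finset_zero hqs
  have key := cauchy_est φ a ha k (fun ν => M ν * q ν)
    (fun ν => mul_nonneg (hM0 ν).le (hq0 ν)) (fun ν hν => by rw [hqs ν hν, mul_zero])
    (lt_of_le_of_lt ((Finset.sum_le_sum fun ν _ =>
      mul_le_of_le_one_left (hq0 ν) (hM1 ν)).trans hqsum) hsR) C (fun w hw => by
      have hle : ∀ ν, ‖w ν / (M ν : ℂ)‖ ≤ q ν := fun ν => by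
        rw [norm_div, Complex.norm_real, Real.norm_of_nonneg (hM0 ν).le, div_le_iff₀ (hM0 ν),
          mul_comm]
        exact hw ν
      refine hC w ⟨fun ν => w ν / (M ν : ℂ), l1_mem (Summable.of_nonneg_of_le
        (fun _ => norm_nonneg _) hle hqh.summable)⟩ ((l1_norm_le hqh hle).trans hqsum) fun ν => ?_
      have : (M ν : ℂ) ≠ 0 := by exact_mod_cast (hM0 ν).ne'
      exact (mul_div_cancel₀ _ this).symm)
  refine le_trans (le_of_eq ?_) key
  have e : ∏ ν ∈ k.support, (M ν * q ν) ^ k ν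
      = (∏ ν ∈ k.support, M ν ^ k ν) * (s ^ knormN k * (kk k / nn k)) := by
    simp only [hq, mul_pow, div_pow, Finset.prod_mul_distrib, Finset.prod_div_distrib,
      Finset.prod_pow_eq_pow_sum, ← hn]
    rfl
  rw [e]
  ring

lemma arith_bound {c p C ε r s : ℝ} (m n : ℕ) (hp : 0 ≤ p) (hc : 0 ≤ c) (hε : 0 < ε)
    (hr : 0 < r) (hs : 0 < s) (h1 : c * s ^ n * p ≤ C) (h2 : ε < c * r ^ n) :
    c * p ^ (m + 1) ≤ (C ^ (m + 1) / ε ^ m) * (1 / s * (r / s) ^ m) ^ n := by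
  have e1 : c * p ≤ C / s ^ n := by
    rw [le_div_iff₀ (by positivity)]; linarith
  have e2 : ε / r ^ n ≤ c := by
    rw [div_le_iff₀ (by positivity)]; exact h2.le
  have e3 : c * p ^ (m + 1) * (ε / r ^ n) ^ m ≤ (C / s ^ n) ^ (m + 1) := by
    calc c * p ^ (m + 1) * (ε / r ^ n) ^ m ≤ c * p ^ (m + 1) * c ^ m := by gcongr
      _ = (c * p) ^ (m + 1) := by ring
      _ ≤ _ := by gcongr
  rw [← le_div_iff₀ (by positivity)] at e3
  refine e3.trans (le_of_eq ?_)
  simp only [div_pow, mul_pow, one_pow, pow_succ]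
  have : (r ^ n) ^ m = (r ^ m) ^ n := by rw [← pow_mul, ← pow_mul, mul_comm]
  have h' : (s ^ n) ^ m = (s ^ m) ^ n := by rw [← pow_mul, ← pow_mul, mul_comm]
  rw [this, h']
  field_simp

open Classical in
/-- The truncated coefficients. -/
noncomputable def truncCoef (a : (ℕ →₀ ℕ) → ℂ) (r ε : ℝ) (k : ℕ →₀ ℕ) : ℂ :=
  if ε < ‖a k‖ * r ^ knormN k * kk k / nn k then a k else 0

lemma trunc_local_bound {r R : ℝ} (hr : 0 < r) (hrR : r < R) (φ : L1 → ℂ)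
    (hol : DifferentiableOn ℂ φ {z : L1 | ‖z‖ < R}) (a : (ℕ →₀ ℕ) → ℂ)
    (ha : ∀ z : L1, ‖z‖ < R → {ν : ℕ | z ν ≠ 0}.Finite →
      Summable (fun k => ‖a k * monom k (fun ν => z ν)‖) ∧
      HasSum (fun k => a k * monom k (fun ν => z ν)) (φ z))
    (ε : ℝ) (hε : 0 < ε) (z : L1) :
    ∃ ρ : ℝ, 0 < ρ ∧ ∃ C : ℝ, ∀ w ∈ ball z ρ, ∀ F : Finset (ℕ →₀ ℕ),
      ∑ k ∈ F, ‖truncCoef a r ε k * monom k (fun ν => w ν)‖ ≤ C := by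
  obtain ⟨s, hrs, hsR⟩ := exists_between hrR
  have hs : 0 < s := hr.trans hrs
  obtain ⟨l, hl0, hl1, hl, hls⟩ := exists_lambda (fun ν => ‖z ν‖) (fun _ => norm_nonneg _)
    (l1_hasSum z).summable
  set X0 := ∑' ν, ‖z ν‖ / l ν with hX0
  have hX00 : 0 ≤ X0 := tsum_nonneg fun ν => div_nonneg (norm_nonneg _) (hl0 ν).le
  have hE := Real.exp_pos 1
  obtain ⟨m, hm⟩ := exists_pow_lt_of_lt_one
    (show 0 < 1 / 2 / (Real.exp 1 * (1 / s) * (X0 + 1)) by positivity) ((div_lt_one hs).2 hrs)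
  set t := 1 / s * (r / s) ^ m with ht
  have ht0 : 0 ≤ t := by positivity
  have htX : Real.exp 1 * t * (X0 + 1) ≤ 1 / 2 := by
    rw [lt_div_iff₀ (by positivity)] at hm
    rw [ht]; linarith
  set μ : ℕ → ℝ := fun ν => l ν ^ (((m + 1 : ℕ) : ℝ)⁻¹) with hμd
  have hμ0 : ∀ ν, 0 < μ ν := fun ν => Real.rpow_pos_of_pos (hl0 ν) _
  have hμ1 : ∀ ν, μ ν ≤ 1 := fun ν => Real.rpow_le_one (hl0 ν).le (hl1 ν) (by positivity)
  have hμp : ∀ ν, μ ν ^ (m + 1) = l ν := fun ν =>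
    Real.rpow_inv_natCast_pow (hl0 ν).le (Nat.succ_ne_zero m)
  have hμ : Tendsto μ atTop (𝓝 0) := by
    have hpos : (0 : ℝ) < (((m + 1 : ℕ) : ℝ)⁻¹) := by positivity
    have := hl.rpow_const (p := (((m + 1 : ℕ) : ℝ)⁻¹)) (Or.inr hpos.le)
    rwa [Real.zero_rpow hpos.ne'] at this
  obtain ⟨η, hη0, hη1, C, hC0, hC⟩ := coef_bound hs hsR φ hol a ha μ hμ0 hμ1 hμ
  set M : ℕ → ℝ := fun ν => max (μ ν) η with hM
  have hM0 : ∀ ν, 0 < M ν := fun ν => lt_max_of_lt_right hη0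
  set D := C ^ (m + 1) / ε ^ m with hD
  have hD0 : 0 ≤ D := by positivity
  refine ⟨η ^ (m + 1), by positivity, D * 2, fun w hw F => ?_⟩
  set x : ℕ → ℝ := fun ν => ‖w ν‖ / M ν ^ (m + 1) with hx
  have hx0 : ∀ ν, 0 ≤ x ν := fun ν => div_nonneg (norm_nonneg _) (pow_nonneg (hM0 ν).le _)
  have hxX : ∀ S : Finset ℕ, ∑ ν ∈ S, x ν ≤ X0 + 1 := by
    intro S
    have h1 : ∀ ν, x ν ≤ ‖z ν‖ / l ν + ‖(w - z) ν‖ / η ^ (m + 1) := by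
      intro ν
      have hw' : ‖w ν‖ ≤ ‖z ν‖ + ‖(w - z) ν‖ := by
        have : w ν = z ν + (w - z) ν := by
          rw [lp.coeFn_sub, Pi.sub_apply]; ring
        calc ‖w ν‖ = ‖z ν + (w - z) ν‖ := by rw [← this]
          _ ≤ _ := norm_add_le _ _
      calc x ν ≤ (‖z ν‖ + ‖(w - z) ν‖) / M ν ^ (m + 1) := by
            have := hM0 ν
            simp only [hx]; gcongr
        _ = ‖z ν‖ / M ν ^ (m + 1) + ‖(w - z) ν‖ / M ν ^ (m + 1) := add_div _ _ _
        _ ≤ _ := by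
            have := hM0 ν
            have h0 := hl0 ν
            have hμν := hμ0 ν
            refine add_le_add ?_ ?_
            · refine div_le_div_of_nonneg_left (norm_nonneg _) h0 ?_
              rw [← hμp ν]
              exact pow_le_pow_left₀ hμν.le (le_max_left _ _) _
            · refine div_le_div_of_nonneg_left (norm_nonneg _) (by positivity) ?_
              exact pow_le_pow_left₀ hη0.le (le_max_right _ _) _
    refine (Finset.sum_le_sum fun ν _ => h1 ν).trans ?_
    rw [Finset.sum_add_distrib, ← Finset.sum_div]
    refine add_le_add (hls.sum_le_tsum S fun ν _ => div_nonneg (norm_nonneg _) (hl0 ν).le) ?_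
    rw [div_le_one (by positivity)]
    refine (sum_le_hasSum S (fun _ _ => norm_nonneg _) (l1_hasSum (w - z))).trans ?_
    rw [mem_ball, dist_eq_norm] at hw
    exact hw.le
  have hterm : ∀ k, ‖truncCoef a r ε k * monom k (fun ν => w ν)‖ ≤
      D * (nn k / kk k * t ^ knormN k * ∏ ν ∈ k.support, x ν ^ k ν) := by
    intro k
    have hkp := kk_pos k
    have hnp := nn_pos k
    have hxp : 0 ≤ ∏ ν ∈ k.support, x ν ^ k ν := Finset.prod_nonneg fun ν _ => pow_nonneg (hx0 ν) _
    unfold truncCoef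
    split_ifs with h
    · set p := ∏ ν ∈ k.support, M ν ^ k ν with hp
      have hp0 : 0 ≤ p := Finset.prod_nonneg fun ν _ => pow_nonneg (hM0 ν).le _
      have hA := arith_bound (c := ‖a k‖ * kk k / nn k) (p := p) m (knormN k) hp0 (by positivity)
        hε hr hs (hC k) (by
          have e : ‖a k‖ * kk k / nn k * r ^ knormN k = ‖a k‖ * r ^ knormN k * kk k / nn k := by ring
          rwa [e])
      have hmon : ‖monom k (fun ν => w ν)‖ = p ^ (m + 1) * ∏ ν ∈ k.support, x ν ^ k ν := by
        unfold monom
        rw [norm_prod, hp, ← Finset.prod_pow, ← Finset.prod_mul_distrib]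
        refine Finset.prod_congr rfl fun ν _ => ?_
        have := hM0 ν
        simp only [hx]
        rw [norm_pow, ← pow_mul, mul_comm (k ν), pow_mul, ← mul_pow]
        congr 1
        field_simp
      rw [norm_mul, hmon]
      calc ‖a k‖ * (p ^ (m + 1) * ∏ ν ∈ k.support, x ν ^ k ν)
          = (nn k / kk k) * ((‖a k‖ * kk k / nn k) * p ^ (m + 1)) * ∏ ν ∈ k.support, x ν ^ k ν := by
            field_simp
        _ ≤ (nn k / kk k) * (D * t ^ knormN k) * ∏ ν ∈ k.support, x ν ^ k ν := by gcongr
        _ = _ := by ring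
    · rw [zero_mul, norm_zero]
      positivity
  refine (Finset.sum_le_sum fun k _ => hterm k).trans ?_
  rw [← Finset.mul_sum]
  exact mul_le_mul_of_nonneg_left (sum_bound x hx0 _ t hxX ht0 htX F) hD0

lemma monom_diff (k : ℕ →₀ ℕ) : Differentiable ℂ (fun z : L1 => monom k (fun ν => z ν)) := by
  unfold monom
  have h : ∀ ν, Differentiable ℂ (fun z : L1 => z ν) := fun ν =>
    (lp.evalCLM ℂ (fun _ : ℕ => ℂ) 1 ν).differentiable
  have h2 : ∀ S : Finset ℕ, Differentiable ℂ (fun z : L1 => ∏ ν ∈ S, z ν ^ k ν) := by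
    intro S
    induction S using Finset.induction_on with
    | empty => simp
    | insert i S hi ih =>
      simp only [Finset.prod_insert hi]
      exact ((h i).pow (k i)).mul ih
  exact h2 _

end part5

/-- Let `0 < r < R < ∞`, let `φ` be holomorphic on `B(R) ⊆ l¹` with monomial
coefficients `(a_k)`, and `ε > 0`. Then there is an entire function `ψ` on `l¹` with monomial
coefficients `(b_k)` such that `sup_k |a_k − b_k|·r^{‖k‖}·k^k/‖k‖^{‖k‖} ≤ ε`. -/
theorem statement14 (r R : ℝ) (hr : 0 < r) (hrR : r < R)
    (φ : L1 → ℂ) (hol : DifferentiableOn ℂ φ {z : L1 | ‖z‖ < R})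
    (a : (ℕ →₀ ℕ) → ℂ)
    (ha : ∀ z : L1, ‖z‖ < R → {ν : ℕ | z ν ≠ 0}.Finite →
      Summable (fun k => ‖a k * monom k (fun ν => z ν)‖) ∧
      HasSum (fun k => a k * monom k (fun ν => z ν)) (φ z))
    (ε : ℝ) (hε : 0 < ε) :
    ∃ ψ : L1 → ℂ, Differentiable ℂ ψ ∧
      ∃ b : (ℕ →₀ ℕ) → ℂ,
        (∀ z : L1, {ν : ℕ | z ν ≠ 0}.Finite →
          Summable (fun k => ‖b k * monom k (fun ν => z ν)‖) ∧
          HasSum (fun k => b k * monom k (fun ν => z ν)) (ψ z)) ∧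
        ∀ k : ℕ →₀ ℕ, ‖a k - b k‖ * r ^ knormN k * kk k / nn k ≤ ε := by
  have hb := trunc_local_bound hr hrR φ hol a ha ε hε
  refine ⟨fun z => ∑' k, truncCoef a r ε k * monom k (fun ν => z ν), fun z => ?_,
    truncCoef a r ε, fun z _ => ?_, fun k => ?_⟩
  · obtain ⟨ρ, hρ, C, hC⟩ := hb z
    exact aux_diff hρ (fun k => (monom_diff k).const_mul _) hC
  · obtain ⟨ρ, hρ, C, hC⟩ := hb z
    have hs : Summable fun k => ‖truncCoef a r ε k * monom k (fun ν => z ν)‖ :=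
      summable_of_sum_le (fun _ => norm_nonneg _) (hC z (Metric.mem_ball_self hρ))
    exact ⟨hs, hs.of_norm.hasSum⟩
  · unfold truncCoef
    split_ifs with h
    · simpa using hε.le
    · rw [sub_zero]
      exact not_lt.1 h
end
end

section
/- Let p ≥ 2 be an integer. There exists a ∂̄-closed (0,1)-form f of class C^{p−1} on the complex Banach space l^p satisfying |f|_{0,B(r)} ≤ r^{p−1} for every r > 0, such that for no nonempty open set Ω ⊆ l^p does there exist a continuously (real Fréchet) differentiable function u : Ω → ℂ with ∂̄u = f on Ω. -/
open Set
open scoped ENNReal NNReal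

noncomputable section

/-- The space `l^p` of `p`-summable sequences of complex numbers. -/
abbrev Lp' (p : ℕ) : Type := lp (fun _ : ℕ => ℂ) p


lemma aux_prod_le {k p : ℕ} (hk : k ≤ p) (a : ℝ) (ha : 0 ≤ a) (b : Fin k → ℝ)
    (hb : ∀ i, 0 ≤ b i) : a ^ (p - k) * ∏ i, b i ≤ a ^ p + ∑ i, b i ^ p := by
  let c : Option (Fin k) → ℝ := fun o => o.elim a b
  obtain ⟨i0, hi0⟩ := Finite.exists_max c
  have hc : ∀ o, 0 ≤ c o := by rintro (_ | i); exacts [ha, hb i]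
  have h1 : a ≤ c i0 := hi0 none
  have h2 : ∀ i, b i ≤ c i0 := fun i => hi0 (some i)
  have h3 : c i0 ^ p ≤ ∑ o, c o ^ p :=
    Finset.single_le_sum (f := fun o => c o ^ p) (fun o _ => pow_nonneg (hc o) p)
      (Finset.mem_univ i0)
  rw [Fintype.sum_option] at h3
  refine le_trans ?_ h3
  calc a ^ (p - k) * ∏ i, b i ≤ c i0 ^ (p - k) * ∏ i : Fin k, c i0 := by
        refine mul_le_mul (pow_le_pow_left₀ ha h1 _) ?_ (Finset.prod_nonneg fun i _ => hb i)
          (pow_nonneg (hc _) _)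
        exact Finset.prod_le_prod (fun i _ => hb i) (fun i _ => h2 i)
    _ = c i0 ^ p := by
        simp only [Finset.prod_const, Finset.card_univ, Fintype.card_fin]
        rw [← pow_add, Nat.sub_add_cancel hk]

lemma aux_holder {k p : ℕ} (hk : k ≤ p) (S : Finset ℕ) (a : ℕ → ℝ) (ha : ∀ n, 0 ≤ a n)
    (b : Fin k → ℕ → ℝ) (hb : ∀ i n, 0 ≤ b i n) (A : ℝ) (hA : 0 < A)
    (B : Fin k → ℝ) (hB : ∀ i, 0 < B i) (h1 : ∑ n ∈ S, a n ^ p ≤ A ^ p)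
    (h2 : ∀ i, ∑ n ∈ S, b i n ^ p ≤ B i ^ p) :
    ∑ n ∈ S, a n ^ (p - k) * ∏ i, b i n ≤ (k + 1) * (A ^ (p - k) * ∏ i, B i) := by
  have hpos : 0 < A ^ (p - k) * ∏ i, B i :=
    mul_pos (pow_pos hA _) (Finset.prod_pos fun i _ => hB i)
  have key : ∀ n, a n ^ (p - k) * ∏ i, b i n ≤
      (A ^ (p - k) * ∏ i, B i) * (a n ^ p / A ^ p + ∑ i, b i n ^ p / B i ^ p) := by
    intro n
    have := aux_prod_le hk (a n / A) (div_nonneg (ha n) hA.le) (fun i => b i n / B i)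
      (fun i => div_nonneg (hb i n) (hB i).le)
    simp only [div_pow, Finset.prod_div_distrib] at this
    rw [div_mul_div_comm, div_le_iff₀ hpos] at this
    linarith
  calc _ ≤ ∑ n ∈ S, (A ^ (p - k) * ∏ i, B i) * (a n ^ p / A ^ p + ∑ i, b i n ^ p / B i ^ p) :=
        Finset.sum_le_sum fun n _ => key n
    _ = (A ^ (p - k) * ∏ i, B i) * ((∑ n ∈ S, a n ^ p) / A ^ p +
          ∑ i, (∑ n ∈ S, b i n ^ p) / B i ^ p) := by
        rw [← Finset.mul_sum, Finset.sum_add_distrib, Finset.sum_div, Finset.sum_comm]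
        simp only [Finset.sum_div]
    _ ≤ (A ^ (p - k) * ∏ i, B i) * (1 + ∑ i : Fin k, 1) := by
        refine mul_le_mul_of_nonneg_left (add_le_add ?_ (Finset.sum_le_sum fun i _ => ?_)) hpos.le
        · exact div_le_one_of_le₀ h1 (pow_pos hA _).le
        · exact div_le_one_of_le₀ (h2 i) (pow_pos (hB i) _).le
    _ = _ := by simp; ring

/-- limit of derivatives along a net, with equicontinuity. -/
lemma aux_hasFDerivAt {ι W G : Type*} [NormedAddCommGroup W] [NormedSpace ℝ W]
    [NormedAddCommGroup G] [NormedSpace ℝ G] {l : Filter ι} [l.NeBot]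
    (F : ι → W → G) (F' : ι → W → W →L[ℝ] G) (f : W → G) (f' : W →L[ℝ] G) (x : W)
    (hF : ∀ i y, HasFDerivAt (F i) (F' i y) y)
    (h1 : ∀ y, Filter.Tendsto (fun i => F i y) l (nhds (f y)))
    (h2 : Filter.Tendsto (fun i => F' i x) l (nhds f'))
    (h3 : ∀ ε > 0, ∃ δ > 0, ∀ i y, ‖y - x‖ < δ → ‖F' i y - F' i x‖ ≤ ε) :
    HasFDerivAt f f' x := by
  rw [hasFDerivAt_iff_isLittleO, Asymptotics.isLittleO_iff]
  intro ε hε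
  obtain ⟨δ, hδ, h⟩ := h3 ε hε
  filter_upwards [Metric.ball_mem_nhds x hδ] with y hy
  have hlim : Filter.Tendsto (fun i => ‖F i y - F i x - F' i x (y - x)‖) l
      (nhds ‖f y - f x - f' (y - x)‖) := by
    refine (((h1 y).sub (h1 x)).sub ?_).norm
    exact ((ContinuousLinearMap.apply ℝ G (y - x)).continuous.tendsto _).comp h2
  refine le_of_tendsto hlim (Filter.Eventually.of_forall fun i => ?_)
  exact (convex_ball x δ).norm_image_sub_le_of_norm_hasFDerivWithin_le'
    (fun z _ => (hF i z).hasFDerivWithinAt)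
    (fun z hz => h i z (by simpa [dist_eq_norm] using hz)) (Metric.mem_ball_self hδ) hy

section series
variable {W E : Type*} [NormedAddCommGroup W] [NormedSpace ℝ W]
  [NormedAddCommGroup E] [NormedSpace ℝ E]

/-- The Taylor coefficients of the terms. -/
def DD (e : ℕ → W →L[ℝ] E) (g : ℕ → E → ℂ) (k n : ℕ) (w : W) :
    ContinuousMultilinearMap ℝ (fun _ : Fin k => W) ℂ :=
  (iteratedFDeriv ℝ k (g n) (e n w)).compContinuousLinearMap (fun _ => e n)

structure SeriesHyp (p m : ℕ) (e : ℕ → W →L[ℝ] E) (g : ℕ → E → ℂ) (d : ℕ → ℝ) (C : ℝ) :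
    Prop where
  hm : m < p
  hC : 0 < C
  he : ∀ w (S : Finset ℕ), ∑ n ∈ S, ‖e n w‖ ^ p ≤ (2 * ‖w‖) ^ p
  hg : ∀ n, ContDiff ℝ m (g n)
  hd0 : ∀ n, 0 ≤ d n
  hd : Summable fun n => d n ^ p
  hb : ∀ n k, k ≤ m → ∀ x, ‖iteratedFDeriv ℝ k (g n) x‖ ≤ C * (‖x‖ + d n) ^ (p - k)

variable {p m : ℕ} {e : ℕ → W →L[ℝ] E} {g : ℕ → E → ℂ} {d : ℕ → ℝ} {C : ℝ}

lemma SeriesHyp.bound (H : SeriesHyp p m e g d C) {k : ℕ} (hk : k ≤ m) (w : W) (S : Finset ℕ)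
    (A : ℝ) (hA : 0 < A) (h : ∑ n ∈ S, (‖e n w‖ + d n) ^ p ≤ A ^ p) :
    ‖∑ n ∈ S, DD e g k n w‖ ≤ C * ((k + 1) * 2 ^ k) * A ^ (p - k) := by
  have hC := H.hC
  refine ContinuousMultilinearMap.opNorm_le_bound (by positivity) fun v => ?_
  by_cases hv : ∃ i, v i = 0
  · obtain ⟨i, hi⟩ := hv
    rw [ContinuousMultilinearMap.map_coord_zero _ i hi, norm_zero]
    positivity
  push Not at hv
  have hh := aux_holder (k := k) (p := p) (hk.trans H.hm.le) S (fun n => ‖e n w‖ + d n)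
    (fun n => add_nonneg (norm_nonneg _) (H.hd0 n)) (fun i n => ‖e n (v i)‖)
    (fun i n => norm_nonneg _) A hA (fun i => 2 * ‖v i‖)
    (fun i => by have := norm_pos_iff.2 (hv i); positivity) h (fun i => H.he (v i) S)
  rw [sum_apply]
  calc _ ≤ ∑ n ∈ S, ‖DD e g k n w v‖ := norm_sum_le _ _
    _ ≤ ∑ n ∈ S, C * ((‖e n w‖ + d n) ^ (p - k) * ∏ i, ‖e n (v i)‖) := by
        refine Finset.sum_le_sum fun n _ => ?_
        rw [DD, ContinuousMultilinearMap.compContinuousLinearMap_apply, ← mul_assoc]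
        refine (ContinuousMultilinearMap.le_opNorm _ _).trans ?_
        exact mul_le_mul_of_nonneg_right (H.hb n k hk _)
          (Finset.prod_nonneg fun i _ => norm_nonneg _)
    _ ≤ C * ((k + 1) * (A ^ (p - k) * ∏ i, (2 * ‖v i‖))) := by
        rw [← Finset.mul_sum]
        exact mul_le_mul_of_nonneg_left hh hC.le
    _ = _ := by
        rw [Finset.prod_mul_distrib]; simp; ring

lemma SeriesHyp.summ (H : SeriesHyp p m e g d C) (w : W) :
    Summable fun n => (‖e n w‖ + d n) ^ p := by
  have h1 : Summable fun n => ‖e n w‖ ^ p :=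
    summable_of_sum_le (fun n => by positivity) (fun S => H.he w S)
  refine Summable.of_nonneg_of_le (fun n => pow_nonneg (add_nonneg (norm_nonneg _) (H.hd0 n)) _)
    (fun n => add_pow_le (norm_nonneg _) (H.hd0 n) p) ((h1.add H.hd).mul_left _)

lemma SeriesHyp.small (H : SeriesHyp p m e g d C) {k : ℕ} (hk : k ≤ m) (w : W) (ε : ℝ)
    (hε : 0 < ε) : ∃ s : Finset ℕ, ∃ δ > 0, ∀ y, ‖y - w‖ < δ → ∀ S : Finset ℕ, Disjoint S s →
      ‖∑ n ∈ S, DD e g k n y‖ ≤ ε := by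
  have hC := H.hC
  have hpk : p - k ≠ 0 := by have := H.hm; omega
  have hp : p ≠ 0 := by have := H.hm; omega
  -- choose A
  obtain ⟨A, hA, hAε⟩ : ∃ A > 0, C * ((k + 1) * 2 ^ k) * A ^ (p - k) ≤ ε := by
    have : Filter.Tendsto (fun A : ℝ => C * ((k + 1) * 2 ^ k) * A ^ (p - k))
        (nhdsWithin 0 (Ioi 0)) (nhds 0) := by
      have h : Continuous (fun A : ℝ => C * ((k + 1) * 2 ^ k) * A ^ (p - k)) := by fun_prop
      have := (h.tendsto 0).mono_left (nhdsWithin_le_nhds (s := Ioi 0))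
      simpa [hpk] using this
    have h2 := (this.eventually (ge_mem_nhds hε)).and self_mem_nhdsWithin
    obtain ⟨A, h3, h4⟩ := h2.exists
    exact ⟨A, h4, h3⟩
  have hη : 0 < A ^ p / (2 ^ (p - 1) * 2) := by positivity
  obtain ⟨s, hs⟩ := summable_iff_vanishing_norm.1 (H.summ w) _ hη
  -- choose δ
  obtain ⟨δ, hδ, hδ2⟩ : ∃ δ > 0, 2 ^ (p - 1) * (2 * δ) ^ p ≤ A ^ p / 2 := by
    have : Filter.Tendsto (fun A : ℝ => 2 ^ (p - 1) * (2 * A) ^ p)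
        (nhdsWithin 0 (Ioi 0)) (nhds 0) := by
      have h : Continuous (fun A : ℝ => 2 ^ (p - 1) * (2 * A) ^ p) := by fun_prop
      have := (h.tendsto 0).mono_left (nhdsWithin_le_nhds (s := Ioi 0))
      simpa [hp] using this
    have h2 := (this.eventually (ge_mem_nhds (show 0 < A ^ p / 2 by positivity))).and
      self_mem_nhdsWithin
    obtain ⟨A, h3, h4⟩ := h2.exists
    exact ⟨A, h4, h3⟩
  refine ⟨s, δ, hδ, fun y hy S hS => (H.bound hk y S A hA ?_).trans hAε⟩
  have h1 := (le_abs_self _).trans (hs S hS).le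
  have h2 : ∑ n ∈ S, ‖e n (y - w)‖ ^ p ≤ (2 * δ) ^ p :=
    (H.he _ S).trans (by gcongr)
  calc ∑ n ∈ S, (‖e n y‖ + d n) ^ p
      ≤ ∑ n ∈ S, 2 ^ (p - 1) * ((‖e n w‖ + d n) ^ p + ‖e n (y - w)‖ ^ p) := by
        refine Finset.sum_le_sum fun n _ => ?_
        have h0 := H.hd0 n
        refine le_trans ?_ (add_pow_le (by positivity) (norm_nonneg _) p)
        have : ‖e n y‖ ≤ ‖e n w‖ + ‖e n (y - w)‖ := by
          have := norm_add_le (e n w) (e n (y - w))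
          rwa [← map_add, add_sub_cancel] at this
        gcongr ?_ ^ p
        linarith
    _ = 2 ^ (p - 1) * (∑ n ∈ S, (‖e n w‖ + d n) ^ p) + 2 ^ (p - 1) * ∑ n ∈ S, ‖e n (y - w)‖ ^ p := by
        rw [← Finset.mul_sum, Finset.sum_add_distrib, mul_add]
    _ ≤ 2 ^ (p - 1) * (A ^ p / (2 ^ (p - 1) * 2)) + 2 ^ (p - 1) * (2 * δ) ^ p := by
        gcongr
    _ ≤ A ^ p / 2 + A ^ p / 2 := by
        gcongr
        apply le_of_eq; field_simp
    _ = A ^ p := by ring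

lemma SeriesHyp.summable (H : SeriesHyp p m e g d C) {k : ℕ} (hk : k ≤ m) (w : W) :
    Summable fun n => DD e g k n w := by
  rw [summable_iff_vanishing_norm]
  intro ε hε
  obtain ⟨s, δ, hδ, h⟩ := H.small hk w (ε / 2) (by positivity)
  exact ⟨s, fun t ht => (h w (by simpa using hδ) t ht).trans_lt (by linarith)⟩

lemma DD_cont (H : SeriesHyp p m e g d C) {k : ℕ} (hk : k ≤ m) (n : ℕ) :
    Continuous (DD e g k n) := by
  have h1 : Continuous (iteratedFDeriv ℝ k (g n)) :=
    (H.hg n).continuous_iteratedFDeriv (by exact_mod_cast hk)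
  exact (ContinuousMultilinearMap.compContinuousLinearMapL (𝕜 := ℝ) (F := ℂ)
    (fun _ : Fin k => e n)).continuous.comp (h1.comp (e n).continuous)

lemma SeriesHyp.equi (H : SeriesHyp p m e g d C) {k : ℕ} (hk : k ≤ m) (w : W) (ε : ℝ)
    (hε : 0 < ε) : ∃ δ > 0, ∀ S : Finset ℕ, ∀ y, ‖y - w‖ < δ →
      ‖∑ n ∈ S, DD e g k n y - ∑ n ∈ S, DD e g k n w‖ ≤ ε := by
  obtain ⟨s, δ, hδ, h⟩ := H.small hk w (ε / 3) (by positivity)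
  have hc : Continuous fun y => ∑ n ∈ s, ‖DD e g k n y - DD e g k n w‖ :=
    continuous_finsetSum _ fun n _ => ((DD_cont H hk n).sub continuous_const).norm
  have ht := hc.tendsto w
  simp only [sub_self, norm_zero, Finset.sum_const_zero] at ht
  obtain ⟨δ2, hδ2, h2⟩ := Metric.eventually_nhds_iff.1
    (ht.eventually (ge_mem_nhds (show 0 < ε / 3 by positivity)))
  refine ⟨min δ δ2, lt_min hδ hδ2, fun S y hy => ?_⟩
  have hsp : ∀ y, ∑ n ∈ S, DD e g k n y =
      ∑ n ∈ S ∩ s, DD e g k n y + ∑ n ∈ S \ s, DD e g k n y := fun y =>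
    (Finset.sum_inter_add_sum_sdiff S s _).symm
  rw [hsp y, hsp w]
  have a1 := h y (hy.trans_le (min_le_left _ _)) (S \ s) Finset.sdiff_disjoint
  have a2 := h w (by simpa using hδ) (S \ s) Finset.sdiff_disjoint
  have a3 : ‖∑ n ∈ S ∩ s, DD e g k n y - ∑ n ∈ S ∩ s, DD e g k n w‖ ≤ ε / 3 := by
    rw [← Finset.sum_sub_distrib]
    refine (norm_sum_le _ _).trans (le_trans ?_ (h2 (y := y) ?_))
    · exact Finset.sum_le_sum_of_subset_of_nonneg Finset.inter_subset_right
        fun _ _ _ => norm_nonneg _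
    · rw [dist_eq_norm]; exact hy.trans_le (min_le_right _ _)
  rw [add_sub_add_comm]
  refine (norm_add_le _ _).trans ?_
  have := norm_sub_le (∑ n ∈ S \ s, DD e g k n y) (∑ n ∈ S \ s, DD e g k n w)
  linarith

lemma DD_hasFDerivAt (H : SeriesHyp p m e g d C) {k : ℕ} (hk : k + 1 ≤ m) (n : ℕ) (w : W) :
    HasFDerivAt (DD e g k n) (DD e g (k + 1) n w).curryLeft w := by
  have hF : ContDiff ℝ m (g n ∘ e n) := (H.hg n).comp (e n).contDiff
  have hDD : ∀ j ≤ m, DD e g j n = iteratedFDeriv ℝ j (g n ∘ e n) := by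
    intro j hj
    ext1 x
    rw [ContinuousLinearMap.iteratedFDeriv_comp_right (e n) (H.hg n) x (by exact_mod_cast hj)]
    rfl
  rw [hDD k (by omega), hDD (k + 1) hk]
  have h1 : DifferentiableAt ℝ (iteratedFDeriv ℝ k (g n ∘ e n)) w :=
    (hF.differentiable_iteratedFDeriv (by exact_mod_cast hk)) w
  have h2 := h1.hasFDerivAt
  have h3 : (iteratedFDeriv ℝ (k + 1) (g n ∘ ⇑(e n)) w).curryLeft =
      fderiv ℝ (iteratedFDeriv ℝ k (g n ∘ ⇑(e n))) w := by
    ext v v'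
    rw [ContinuousMultilinearMap.curryLeft_apply, iteratedFDeriv_succ_apply_left]
    simp
  rw [h3]
  exact h2

lemma curryLeft_hasSum {k : ℕ} {f : ℕ → ContinuousMultilinearMap ℝ (fun _ : Fin (k + 1) => W) ℂ}
    {a : ContinuousMultilinearMap ℝ (fun _ : Fin (k + 1) => W) ℂ} (h : HasSum f a) :
    HasSum (fun n => (f n).curryLeft) a.curryLeft := by
  have := (continuousMultilinearCurryLeftEquiv ℝ (fun _ : Fin (k + 1) => W)
    ℂ).toContinuousLinearEquiv.toContinuousLinearMap.hasSum h
  exact this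

lemma curryLeft_sum_norm {k : ℕ} (f f' : ℕ → ContinuousMultilinearMap ℝ (fun _ : Fin (k + 1) => W) ℂ)
    (S : Finset ℕ) : ‖∑ n ∈ S, (f n).curryLeft - ∑ n ∈ S, (f' n).curryLeft‖ =
      ‖∑ n ∈ S, f n - ∑ n ∈ S, f' n‖ := by
  rw [← ContinuousMultilinearMap.curryLeft_norm (∑ n ∈ S, f n - ∑ n ∈ S, f' n)]
  congr 1
  ext v v'
  simp [sum_apply]

theorem SeriesHyp.main (H : SeriesHyp p m e g d C) :
    ContDiff ℝ m (fun w => ∑' n, g n (e n w)) ∧ (∀ w, Summable fun n => g n (e n w)) ∧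
    (1 ≤ m → ∀ w h, HasSum (fun n => fderiv ℝ (g n) (e n w) (e n h))
      (fderiv ℝ (fun w => ∑' n, g n (e n w)) w h)) := by
  let P : W → FormalMultilinearSeries ℝ W ℂ := fun w k => ∑' n, DD e g k n w
  have hsum0 : ∀ w, HasSum (fun n => g n (e n w)) (P w 0 0) := by
    intro w
    have := (H.summable (Nat.zero_le m) w).hasSum
    have := ContinuousMultilinearMap.hasSum_eval this (0 : Fin 0 → W)
    have h2 : (fun n => g n (e n w)) = fun n => DD e g 0 n w 0 := by
      funext n; simp [DD]
    rw [h2]; exact this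
  have hder : ∀ k < m, ∀ x, HasFDerivAt (fun w => P w k) (P x (k + 1)).curryLeft x := by
    intro k hk x
    refine aux_hasFDerivAt (l := (Filter.atTop : Filter (Finset ℕ)))
      (fun S y => ∑ n ∈ S, DD e g k n y)
      (fun S y => ∑ n ∈ S, (DD e g (k + 1) n y).curryLeft) _ _ x
      (fun S y => HasFDerivAt.fun_sum fun n _ => DD_hasFDerivAt H hk n y)
      (fun y => (H.summable hk.le y).hasSum) ?_ ?_
    · exact curryLeft_hasSum (H.summable (k := k + 1) hk x).hasSum
    · intro ε hε
      obtain ⟨δ, hδ, h⟩ := H.equi (k := k + 1) hk x ε hε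
      refine ⟨δ, hδ, fun S y hy => ?_⟩
      refine le_trans (le_of_eq ?_) (h S y hy)
      exact curryLeft_sum_norm _ _ S
  have hT : HasFTaylorSeriesUpTo ((m : ℕ∞) : WithTop ℕ∞) (fun w => ∑' n, g n (e n w)) P := by
    refine ⟨fun w => ?_, ?_, ?_⟩
    · exact (hsum0 w).tsum_eq.symm
    · intro k hk x
      exact hder k (by exact_mod_cast hk) x
    · intro k hk
      have hk : k ≤ m := by exact_mod_cast hk
      rw [continuous_iff_continuousAt]
      intro x
      rw [Metric.continuousAt_iff]
      intro ε hε
      obtain ⟨δ, hδ, h⟩ := H.equi (k := k) hk x (ε / 2) (by positivity)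
      refine ⟨δ, hδ, fun y hy => ?_⟩
      rw [dist_eq_norm] at hy ⊢
      refine lt_of_le_of_lt ?_ (half_lt_self hε)
      exact le_of_tendsto (((H.summable hk y).hasSum.sub (H.summable hk x).hasSum).norm)
        (Filter.Eventually.of_forall fun S => by
          have := h S y hy
          rw [← Finset.sum_sub_distrib] at this; exact this)
  refine ⟨by exact_mod_cast hT.contDiff, fun w => (hsum0 w).summable, fun hm w h => ?_⟩
  have h1 := hT.hasFDerivAt (by exact_mod_cast (by omega : m ≠ 0)) w
  rw [h1.fderiv]
  have := (H.summable hm w).hasSum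
  have := ContinuousMultilinearMap.hasSum_eval this (fun _ : Fin 1 => h)
  have h2 : (fun n => fderiv ℝ (g n) (e n w) (e n h)) = fun n => DD e g 1 n w (fun _ => h) := by
    funext n; simp [DD, iteratedFDeriv_one_apply]
  rw [h2]; exact this
end series

def phiF (p : ℕ) (δ : ℝ) (z : ℂ) : ℂ := z ^ (p + 1) / ((‖z‖ ^ 2 + δ ^ 2 : ℝ) : ℂ)

def gF (p : ℕ) (δ : ℝ) (x : ℂ × ℂ) : ℂ := phiF p δ x.1 * (starRingEnd ℂ) x.2

def GG (p : ℕ) (y : (ℂ × ℝ) × ℂ) : ℂ := phiF p y.1.2 y.1.1 * (starRingEnd ℂ) y.2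

lemma phiF_norm (p : ℕ) (hp : 1 ≤ p) (δ : ℝ) (z : ℂ) : ‖phiF p δ z‖ ≤ ‖z‖ ^ (p - 1) := by
  rw [phiF, norm_div, norm_pow, Complex.norm_real, Real.norm_of_nonneg (by positivity)]
  refine div_le_of_le_mul₀ (by positivity) (by positivity) ?_
  rw [show p + 1 = (p - 1) + 2 by omega, pow_add]
  gcongr
  nlinarith [sq_nonneg δ]

lemma conj_contDiff : ContDiff ℝ ⊤ (fun z : ℂ => (starRingEnd ℂ) z) :=
  Complex.conjCLE.contDiff

lemma GG_contDiffOn (p : ℕ) : ContDiffOn ℝ ⊤ (GG p) {y | y.1 ≠ 0} := by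
  unfold GG phiF
  simp only [div_eq_mul_inv]
  refine ContDiffOn.mul (ContDiffOn.mul ?_ (ContDiffOn.inv ?_ ?_)) ?_
  · fun_prop
  · refine ContDiff.contDiffOn ?_
    refine Complex.ofRealCLM.contDiff.comp ?_
    exact (ContDiff.norm_sq ℝ (by fun_prop)).add (by fun_prop)
  · rintro ⟨⟨z, d⟩, x⟩ h
    simp only [ne_eq, Prod.mk_eq_zero, mem_ofPred_eq] at h ⊢
    norm_cast
    intro h0
    apply h
    have h1 : ‖z‖ ^ 2 = 0 := by nlinarith [sq_nonneg ‖z‖, sq_nonneg d]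
    have h2 : d ^ 2 = 0 := by nlinarith [sq_nonneg ‖z‖, sq_nonneg d]
    exact ⟨by simpa using h1, by simpa using h2⟩
  · exact (conj_contDiff.comp contDiff_snd).contDiffOn

lemma phiF_contDiff (p : ℕ) (δ : ℝ) (hδ : 0 < δ) : ContDiff ℝ ⊤ (phiF p δ) := by
  unfold phiF
  simp only [div_eq_mul_inv]
  refine ContDiff.mul ?_ (ContDiff.inv ?_ ?_)
  · fun_prop
  · refine Complex.ofRealCLM.contDiff.comp ?_
    exact (ContDiff.norm_sq ℝ (by fun_prop)).add (by fun_prop)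
  · intro z
    norm_cast
    positivity

lemma gF_contDiff (p : ℕ) (δ : ℝ) (hδ : 0 < δ) : ContDiff ℝ ⊤ (gF p δ) :=
  ((phiF_contDiff p δ hδ).comp contDiff_fst).mul (conj_contDiff.comp contDiff_snd)

lemma gF_bound (p : ℕ) : ∃ C > 0, ∀ δ : ℝ, 0 < δ → ∀ k, k + 1 ≤ p → ∀ x : ℂ × ℂ,
    ‖iteratedFDeriv ℝ k (gF p δ) x‖ ≤ C * (‖x‖ + δ) ^ (p - k) := by
  set t : Set ((ℂ × ℝ) × ℂ) := {y | y.1 ≠ 0} with ht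
  have hto : IsOpen t := isOpen_ne_fun continuous_fst continuous_const
  have hK : IsCompact ((Metric.sphere (0 : ℂ × ℝ) 1) ×ˢ (Metric.closedBall (0 : ℂ) 1)) :=
    (isCompact_sphere _ _).prod (isCompact_closedBall _ _)
  have hKt : ((Metric.sphere (0 : ℂ × ℝ) 1) ×ˢ (Metric.closedBall (0 : ℂ) 1)) ⊆ t := by
    rintro ⟨y, x⟩ ⟨h1, h2⟩ h0
    simp only at h0 h1
    subst h0
    simp at h1
  have h1 : ∀ k : ℕ, ∃ C, ∀ y ∈ (Metric.sphere (0 : ℂ × ℝ) 1) ×ˢ (Metric.closedBall (0 : ℂ) 1),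
      ‖iteratedFDerivWithin ℝ k (GG p) t y‖ ≤ C := fun k =>
    hK.exists_bound_of_continuousOn
      (((GG_contDiffOn p).continuousOn_iteratedFDerivWithin (by simp)
        hto.uniqueDiffOn).mono hKt)
  choose c hc using h1
  have hc0 : ∀ k, c k ≤ ∑ i ∈ Finset.range (p + 1), |c i| + |c k| := fun k => by
    have : 0 ≤ ∑ i ∈ Finset.range (p + 1), |c i| := Finset.sum_nonneg fun _ _ => abs_nonneg _
    have := le_abs_self (c k); linarith
  set M := ∑ i ∈ Finset.range (p + 1), |c i| with hM
  have hM0 : 0 ≤ M := Finset.sum_nonneg fun _ _ => abs_nonneg _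
  have hcM : ∀ k ≤ p, c k ≤ M := fun k hk => (le_abs_self _).trans
    (Finset.single_le_sum (f := fun i => |c i|) (fun _ _ => abs_nonneg _)
      (Finset.mem_range.2 (by omega)))
  refine ⟨p.factorial * M + 1, by positivity, fun δ hδ k hk x => ?_⟩
  set R : ℝ := ‖(x.1, δ)‖ with hR
  have hRδ : δ ≤ R := by
    have := norm_snd_le (x.1, δ); simp only [Real.norm_eq_abs] at this
    exact (le_abs_self δ).trans this
  have hR0 : 0 < R := hδ.trans_le hRδ
  set R' : ℝ := ‖x‖ + δ with hR'
  have hRR' : R ≤ R' := by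
    have := norm_fst_le x
    rw [hR, Prod.norm_def]
    refine max_le (by simp only; linarith) ?_
    simp only [Real.norm_eq_abs, abs_of_pos hδ]
    linarith [norm_nonneg x]
  have hR'0 : 0 < R' := hR0.trans_le hRR'
  let L : ℂ × ℂ →L[ℝ] (ℂ × ℝ) × ℂ :=
    ((R⁻¹ • ContinuousLinearMap.fst ℝ ℂ ℂ).prod 0).prod (R'⁻¹ • ContinuousLinearMap.snd ℝ ℂ ℂ)
  let f : ℂ × ℂ → (ℂ × ℝ) × ℂ := fun y => L y + ((0, R⁻¹ * δ), 0)
  have hfy : ∀ y, f y = ((R⁻¹ • y.1, R⁻¹ * δ), R'⁻¹ • y.2) := by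
    intro y; simp [f, L]
  have hLn : ‖L‖ ≤ R⁻¹ := by
    refine ContinuousLinearMap.opNorm_le_bound _ (by positivity) fun y => ?_
    have e1 : L y = ((R⁻¹ • y.1, 0), R'⁻¹ • y.2) := by simp [L]
    rw [e1]
    have a1 := norm_fst_le y
    have a2 := norm_snd_le y
    refine norm_prod_le_iff.2 ⟨norm_prod_le_iff.2 ⟨?_, ?_⟩, ?_⟩
    · simp only [norm_smul, norm_inv, Real.norm_eq_abs, abs_of_pos hR0]
      gcongr
    · simp only [norm_zero]; positivity
    · simp only [norm_smul, norm_inv, Real.norm_eq_abs, abs_of_pos hR'0]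
      gcongr
  have hfc : ContDiff ℝ ⊤ f := L.contDiff.add contDiff_const
  have hff : fderiv ℝ f = fun _ => L := by
    funext y
    exact (L.hasFDerivAt.add_const _).fderiv
  have hfx : f x ∈ (Metric.sphere (0 : ℂ × ℝ) 1) ×ˢ (Metric.closedBall (0 : ℂ) 1) := by
    rw [hfy]
    refine ⟨?_, ?_⟩
    · have : (R⁻¹ • x.1, R⁻¹ * δ) = R⁻¹ • (x.1, δ) := by simp
      simp only [mem_sphere_iff_norm, sub_zero]
      rw [this, norm_smul, ← hR, norm_inv, Real.norm_eq_abs, abs_of_pos hR0,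
        inv_mul_cancel₀ hR0.ne']
    · simp only [Metric.mem_closedBall, dist_zero_right, norm_smul, norm_inv, Real.norm_eq_abs,
        abs_of_pos hR'0]
      rw [inv_mul_le_one₀ hR'0]
      have := norm_snd_le x
      linarith
  have hrange : range f ⊆ t := by
    rintro _ ⟨y, rfl⟩
    rw [hfy, ht]
    simp [hR0.ne', hδ.ne']
  have key := norm_iteratedFDeriv_comp_le' (𝕜 := ℝ) (n := k) (N := ⊤) (g := GG p) (f := f)
    hrange hto.uniqueDiffOn (GG_contDiffOn p) hfc (by simp) x (C := M) (D := R⁻¹)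
    (fun i hi => (hc i _ hfx).trans (hcM i (by omega))) (by
      intro i hi1 hi2
      obtain ⟨j, rfl⟩ : ∃ j, i = j + 1 := ⟨i - 1, by omega⟩
      rw [← norm_iteratedFDeriv_fderiv, hff]
      rcases Nat.eq_zero_or_pos j with rfl | hj
      · simpa using hLn
      · rw [iteratedFDeriv_const_of_ne hj.ne']
        simp only [Pi.zero_apply, norm_zero]
        positivity)
  have hcomp : gF p δ = (R ^ (p - 1) * R') • (GG p ∘ f) := by
    funext y
    simp only [Pi.smul_apply, Function.comp, hfy, GG, gF, phiF, Complex.real_smul]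
    have e1 : ‖(R⁻¹ : ℝ) • y.1‖ ^ 2 + (R⁻¹ * δ) ^ 2 = (R⁻¹) ^ 2 * (‖y.1‖ ^ 2 + δ ^ 2) := by
      rw [norm_smul, norm_inv, Real.norm_eq_abs, abs_of_pos hR0]; ring
    rw [Complex.real_smul] at e1
    rw [e1]
    have hq : ((‖y.1‖ ^ 2 + δ ^ 2 : ℝ) : ℂ) ≠ 0 := by norm_cast; positivity
    have hRc : (R : ℂ) ≠ 0 := by exact_mod_cast hR0.ne'
    have hRc' : (R' : ℂ) ≠ 0 := by exact_mod_cast hR'0.ne'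
    rw [map_mul, Complex.conj_ofReal, Complex.ofReal_mul ((R⁻¹) ^ 2), mul_pow]
    rw [show p + 1 = (p - 1) + 2 by omega]
    generalize ((‖y.1‖ ^ 2 + δ ^ 2 : ℝ) : ℂ) = q at *
    push_cast
    rw [inv_pow, inv_pow, pow_add (R : ℂ)]
    field_simp
  rw [hcomp, iteratedFDeriv_const_smul_apply
    (((GG_contDiffOn p).comp_contDiff hfc (fun y => hrange ⟨y, rfl⟩)).contDiffAt.of_le (by simp)),
    norm_smul, Real.norm_of_nonneg (by positivity)]
  calc R ^ (p - 1) * R' * ‖iteratedFDeriv ℝ k (GG p ∘ f) x‖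
      ≤ R ^ (p - 1) * R' * (k.factorial * M * R⁻¹ ^ k) := by gcongr
    _ = k.factorial * M * (R ^ (p - 1 - k) * R') := by
        rw [show p - 1 = (p - 1 - k) + k by omega, pow_add, Nat.add_sub_cancel, inv_pow]
        field_simp
    _ ≤ (p.factorial * M + 1) * (R' ^ (p - 1 - k) * R') := by
        gcongr
        have : (k.factorial : ℝ) ≤ p.factorial := by exact_mod_cast Nat.factorial_le (by omega)
        nlinarith
    _ = _ := by rw [← pow_succ, show p - 1 - k + 1 = p - k by omega]

lemma taylor_avg (p : ℕ) (hp : 2 ≤ p) (k : ℂ → ℂ) (R ρ M t : ℝ) (hρ : 0 < ρ) (hρR : ρ < R)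
    (hk : DifferentiableOn ℂ k (Metric.ball 0 R)) (hM : ∀ z ∈ Metric.sphere (0 : ℂ) ρ, ‖k z‖ ≤ M)
    (ht : 0 ≤ t) (htρ : t ≤ ρ / 2) (ω : ℂ) (hω : IsPrimitiveRoot ω p) :
    ‖∑ j ∈ Finset.range p, k (ω ^ j * t) - p * k 0‖ ≤ p * (2 * M * (t / ρ) ^ p) := by
  have hω1 : ‖ω‖ = 1 := hω.norm'_eq_one (by omega)
  have hn : ∀ j, ‖ω ^ j * (t : ℂ)‖ = t := fun j => by
    rw [norm_mul, norm_pow, hω1, one_pow, one_mul, Complex.norm_real, Real.norm_of_nonneg ht]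
  have hM0 : 0 ≤ M := (norm_nonneg _).trans (hM (ρ : ℂ) (by simp [abs_of_pos hρ]))
  set a : ℕ → ℂ := fun n => (n.factorial : ℂ)⁻¹ * iteratedDeriv n k 0 with ha
  have hser : ∀ z ∈ Metric.ball (0 : ℂ) R, HasSum (fun n => z ^ n * a n) (k z) := by
    intro z hz
    have := Complex.hasSum_taylorSeries_on_ball hk hz
    refine this.congr_fun ?_ 
    intro n
    simp only [sub_zero, smul_eq_mul, ha]; ring
  have hcl : DiffContOnCl ℂ k (Metric.ball 0 ρ) := by
    refine DifferentiableOn.diffContOnCl ?_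
    rw [closure_ball _ hρ.ne']
    exact hk.mono (Metric.closedBall_subset_ball hρR)
  have han : ∀ n, ‖a n‖ ≤ M / ρ ^ n := by
    intro n
    have := Complex.norm_iteratedDeriv_le_of_forall_mem_sphere_norm_le n hρ hcl hM
    rw [ha]
    simp only [norm_mul, norm_inv, Complex.norm_natCast]
    rw [inv_mul_le_iff₀ (by positivity)]
    rw [← mul_div_assoc]; exact this
  set b : ℕ → ℂ := fun n => ∑ j ∈ Finset.range p, (ω ^ j * (t : ℂ)) ^ n * a n with hb
  have hbs : HasSum b (∑ j ∈ Finset.range p, k (ω ^ j * t)) := by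
    refine hasSum_sum fun j _ => hser _ ?_
    rw [mem_ball_zero_iff, hn]; linarith
  have hb0 : b 0 = p * k 0 := by
    simp [hb, ha]
  have hbz : ∀ n, 0 < n → n < p → b n = 0 := by
    intro n h0 h1
    have hne : ω ^ n ≠ 1 := hω.pow_ne_one_of_pos_of_lt h0.ne' h1
    have : ∑ j ∈ Finset.range p, (ω ^ n) ^ j = 0 := by
      rw [geom_sum_eq hne, ← pow_mul, mul_comm n p, pow_mul, hω.pow_eq_one, one_pow, sub_self,
        zero_div]
    calc b n = (∑ j ∈ Finset.range p, (ω ^ n) ^ j) * ((t : ℂ) ^ n * a n) := by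
          rw [hb, Finset.sum_mul]
          refine Finset.sum_congr rfl fun j _ => ?_
          rw [mul_pow, ← pow_mul, ← pow_mul, mul_comm j n]; ring
      _ = 0 := by rw [this, zero_mul]
  have hbn : ∀ n, ‖b (n + p)‖ ≤ p * (M * (t / ρ) ^ p) * (1 / 2) ^ n := by
    intro n
    calc ‖b (n + p)‖ ≤ ∑ j ∈ Finset.range p, t ^ (n + p) * (M / ρ ^ (n + p)) := by
          refine (norm_sum_le _ _).trans (Finset.sum_le_sum fun j _ => ?_)
          rw [norm_mul, norm_pow, hn]
          gcongr
          exact han _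
      _ = p * (M * (t / ρ) ^ p) * (t / ρ) ^ n := by
          simp only [Finset.sum_const, Finset.card_range, nsmul_eq_mul, div_pow, pow_add]
          field_simp
      _ ≤ _ := by
          refine mul_le_mul_of_nonneg_left (pow_le_pow_left₀ (by positivity) ?_ n) (by positivity)
          rw [div_le_iff₀ hρ]; linarith
  have h2 := (hasSum_nat_add_iff' p).2 hbs
  have h3 : ∑ i ∈ Finset.range p, b i = p * k 0 := by
    rw [← hb0]
    refine Finset.sum_eq_single_of_mem 0 (Finset.mem_range.2 (by omega)) ?_
    intro n hn hn0
    exact hbz n (by omega) (Finset.mem_range.1 hn)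
  rw [h3] at h2
  have h4 := hasSum_geometric_two.mul_left (p * (M * (t / ρ) ^ p))
  have := tsum_of_norm_bounded h4 hbn
  rw [h2.tsum_eq] at this
  linarith

def UF (p : ℕ) (δ : ℝ) (z : ℂ) : ℂ := z ^ p * ((Real.log (‖z‖ ^ 2 + δ ^ 2) : ℝ) : ℂ)


lemma UF_dbar (p : ℕ) (hp : 1 ≤ p) (δ : ℝ) (hδ : 0 < δ) (z : ℂ) : DifferentiableAt ℝ (UF p δ) z ∧
    (fderiv ℝ (UF p δ) z 1 + Complex.I * fderiv ℝ (UF p δ) z Complex.I) / 2 = phiF p δ z := by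
  have hq : 0 < ‖z‖ ^ 2 + δ ^ 2 := by positivity
  have h1 : HasFDerivAt (fun z : ℂ => ‖z‖ ^ 2 + δ ^ 2) (2 • innerSL ℝ z) z :=
    (hasStrictFDerivAt_norm_sq z).hasFDerivAt.add_const _
  have h2 := Complex.ofRealCLM.hasFDerivAt.comp z (h1.log hq.ne')
  have h3 : HasFDerivAt (fun z : ℂ => z ^ p) _ z :=
    ((hasDerivAt_pow p z).hasFDerivAt).restrictScalars ℝ
  have h4 := h3.mul h2
  have h5 : HasFDerivAt (UF p δ) _ z := h4
  refine ⟨h5.differentiableAt, ?_⟩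
  rw [h5.fderiv]
  have hq' : ((‖z‖ ^ 2 + δ ^ 2 : ℝ) : ℂ) ≠ 0 := by exact_mod_cast hq.ne'
  have hz : (starRingEnd ℂ) z = (z.re : ℂ) - z.im * Complex.I := by
    apply Complex.ext <;> simp
  have hz2 : z = (z.re : ℂ) + z.im * Complex.I := (Complex.re_add_im z).symm
  have e : z ^ p = z ^ (p - 1) * z := by rw [← pow_succ, Nat.sub_add_cancel hp]
  have hI := Complex.I_sq
  simp [phiF, Complex.inner, -Complex.ofReal_add, -Complex.ofReal_pow]
  generalize ((‖z‖ ^ 2 + δ ^ 2 : ℝ) : ℂ) = q at *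
  rw [pow_succ z p, div_eq_mul_inv _ q]
  linear_combination (-(z ^ p * q⁻¹)) * hz2 +
    (Real.log (‖z‖ ^ 2 + δ ^ 2) : ℂ) * (p * z ^ (p - 1)) / 2 * hI

structure CoordHyp {V : Type*} [NormedAddCommGroup V] [NormedSpace ℂ V] (p : ℕ)
    (c : ℕ → V →L[ℂ] ℂ) (e : ℕ → V) : Prop where
  hc : ∀ v (S : Finset ℕ), ∑ n ∈ S, ‖c n v‖ ^ p ≤ ‖v‖ ^ p
  he : ∀ n m, c n (e m) = if n = m then 1 else 0
  hn : ∀ n v (a : ℂ), c n v = 0 → ‖v + a • e n‖ ^ p = ‖v‖ ^ p + ‖a‖ ^ p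
  hd : ∀ v (ε : ℝ), 0 < ε → ∃ v', ‖v' - v‖ < ε ∧ ∃ N, ∀ n ≥ N, c n v' = 0

def dl (n : ℕ) : ℝ := (1 / 2) ^ n

lemma dl_pos (n : ℕ) : 0 < dl n := by unfold dl; positivity

lemma dl_le (n : ℕ) : dl n ≤ 1 := pow_le_one₀ (by norm_num) (by norm_num)

def FF {V : Type*} [NormedAddCommGroup V] [NormedSpace ℂ V] (p : ℕ)
    (c : ℕ → V →L[ℂ] ℂ) (z ξ : V) : ℂ := ∑' n, gF p (dl n) (c n z, c n ξ)

def ee {V : Type*} [NormedAddCommGroup V] [NormedSpace ℂ V]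
    (c : ℕ → V →L[ℂ] ℂ) (n : ℕ) : V × V →L[ℝ] ℂ × ℂ :=
  ((c n).restrictScalars ℝ).prodMap ((c n).restrictScalars ℝ)

section
variable {V : Type*} [NormedAddCommGroup V] [NormedSpace ℂ V] {p : ℕ}
    {c : ℕ → V →L[ℂ] ℂ} {e : ℕ → V}

lemma ee_apply (n : ℕ) (w : V × V) : ee c n w = (c n w.1, c n w.2) := rfl

lemma CoordHyp.series (H : CoordHyp p c e) (hp : 2 ≤ p) :
    ∃ C, SeriesHyp p (p - 1) (ee c) (fun n => gF p (dl n)) dl C := by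
  obtain ⟨C, hC, hb⟩ := gF_bound p
  refine ⟨C, ⟨by omega, hC, ?_, ?_, fun n => (dl_pos n).le, ?_, ?_⟩⟩
  · intro w S
    have h1 : ∀ n, ‖ee c n w‖ ^ p ≤ ‖c n w.1‖ ^ p + ‖c n w.2‖ ^ p := by
      intro n
      rw [ee_apply, Prod.norm_def]
      rcases le_total ‖c n w.1‖ ‖c n w.2‖ with h | h
      · rw [max_eq_right h]; have := pow_nonneg (norm_nonneg (c n w.1)) p; linarith
      · rw [max_eq_left h]; have := pow_nonneg (norm_nonneg (c n w.2)) p; linarith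
    calc ∑ n ∈ S, ‖ee c n w‖ ^ p ≤ ∑ n ∈ S, (‖c n w.1‖ ^ p + ‖c n w.2‖ ^ p) :=
          Finset.sum_le_sum fun n _ => h1 n
      _ ≤ ‖w.1‖ ^ p + ‖w.2‖ ^ p := by
          rw [Finset.sum_add_distrib]; exact add_le_add (H.hc _ _) (H.hc _ _)
      _ ≤ ‖w‖ ^ p + ‖w‖ ^ p := add_le_add
          (pow_le_pow_left₀ (norm_nonneg _) (norm_fst_le w) p)
          (pow_le_pow_left₀ (norm_nonneg _) (norm_snd_le w) p)
      _ ≤ (2 * ‖w‖) ^ p := by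
          rw [mul_pow]
          have : (2 : ℝ) ≤ 2 ^ p := by
            calc (2 : ℝ) = 2 ^ 1 := by norm_num
              _ ≤ 2 ^ p := pow_le_pow_right₀ (by norm_num) (by omega)
          nlinarith [pow_nonneg (norm_nonneg w) p]
  · intro n
    exact (gF_contDiff p _ (dl_pos n)).of_le (by exact le_top)
  · have : (fun n => dl n ^ p) = fun n => ((1 / 2 : ℝ) ^ p) ^ n := by
      funext n; simp only [dl]; rw [← pow_mul, ← pow_mul, mul_comm]
    rw [this]
    exact summable_geometric_of_lt_one (by positivity)
      (pow_lt_one₀ (by norm_num) (by norm_num) (by omega))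
  · intro n k hk x
    exact hb _ (dl_pos n) k (by omega) x

lemma CoordHyp.smooth (H : CoordHyp p c e) (hp : 2 ≤ p) :
    ContDiff ℝ (p - 1 : ℕ) (fun w : V × V => FF p c w.1 w.2) := by
  obtain ⟨C, hS⟩ := H.series hp
  exact hS.main.1

lemma CoordHyp.summ (H : CoordHyp p c e) (hp : 2 ≤ p) (z ξ : V) :
    Summable fun n => gF p (dl n) (c n z, c n ξ) := by
  obtain ⟨C, hS⟩ := H.series hp
  exact hS.main.2.1 (z, ξ)

lemma CoordHyp.form (H : CoordHyp p c e) (hp : 2 ≤ p) : IsForm01 (p - 1) univ (FF p c) := by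
  refine ⟨fun z _ ξ η => ?_, fun z _ a ξ => ?_, (H.smooth hp).contDiffOn⟩
  · simp only [FF]
    rw [← (H.summ hp z ξ).tsum_add (H.summ hp z η)]
    congr 1; funext n
    simp only [gF, map_add]; ring
  · simp only [FF]
    rw [← tsum_mul_left]
    congr 1; funext n
    simp only [gF, map_smul, smul_eq_mul, map_mul]; ring

lemma real_lin (L : ℂ →L[ℝ] ℂ) (η : ℂ) : L η + Complex.I * L (Complex.I * η) =
    (starRingEnd ℂ) η * (L 1 + Complex.I * L Complex.I) := by
  have h1 : L η = η.re * L 1 + η.im * L Complex.I := by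
    conv_lhs => rw [show η = η.re • (1 : ℂ) + η.im • Complex.I by
      apply Complex.ext <;> simp]
    rw [map_add, map_smul, map_smul, Complex.real_smul, Complex.real_smul]
  have h2 : L (Complex.I * η) = η.re * L Complex.I - η.im * L 1 := by
    conv_lhs => rw [show Complex.I * η = η.re • Complex.I - η.im • (1 : ℂ) by
      apply Complex.ext <;> simp]
    rw [map_sub, map_smul, map_smul, Complex.real_smul, Complex.real_smul]
  have h3 : (starRingEnd ℂ) η = η.re - η.im * Complex.I := by
    apply Complex.ext <;> simp
  rw [h1, h2, h3]
  linear_combination ((η.im : ℂ) * L Complex.I) * Complex.I_sq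

lemma CoordHyp.dbar_hasSum (H : CoordHyp p c e) (hp : 2 ≤ p) (z ξ η : V) :
    HasSum (fun n => (starRingEnd ℂ) (c n ξ) * (starRingEnd ℂ) (c n η) *
      ((fderiv ℝ (phiF p (dl n)) (c n z) 1 +
        Complex.I * fderiv ℝ (phiF p (dl n)) (c n z) Complex.I) / 2))
      (dbar (fun w => FF p c w ξ) z η) := by
  obtain ⟨C, hS⟩ := H.series hp
  have hm := hS.main.2.2 (by omega) (z, ξ)
  have hd : Differentiable ℝ (fun w : V × V => FF p c w.1 w.2) :=
    (H.smooth hp).differentiable (by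
      have : (p - 1 : ℕ) ≠ 0 := by omega
      exact_mod_cast this)
  have e1 : ∀ h, fderiv ℝ (fun w => FF p c w ξ) z h =
      fderiv ℝ (fun w : V × V => FF p c w.1 w.2) (z, ξ) (h, 0) := by
    intro h
    have h1 : HasFDerivAt (fun w : V => (w, ξ)) (ContinuousLinearMap.inl ℝ V V) z :=
      hasFDerivAt_prodMk_left z ξ
    have := (hd (z, ξ)).hasFDerivAt.comp z h1
    have h2 : fderiv ℝ (fun w => FF p c w ξ) z = _ := this.fderiv
    rw [h2]; rfl
  have e2 : ∀ n h, fderiv ℝ (gF p (dl n)) (ee c n (z, ξ)) (ee c n (h, 0)) =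
      (starRingEnd ℂ) (c n ξ) * fderiv ℝ (phiF p (dl n)) (c n z) (c n h) := by
    intro n h
    have hφ : HasFDerivAt (phiF p (dl n)) _ (c n z) :=
      ((phiF_contDiff p _ (dl_pos n)).differentiable (by simp) (c n z)).hasFDerivAt
    have h1 : HasFDerivAt (fun x : ℂ × ℂ => phiF p (dl n) x.1) _ (c n z, c n ξ) :=
      HasFDerivAt.comp (f := Prod.fst) (g := phiF p (dl n)) (c n z, c n ξ) hφ hasFDerivAt_fst
    have h2 : HasFDerivAt (fun x : ℂ × ℂ => (starRingEnd ℂ) x.2) _ (c n z, c n ξ) :=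
      HasFDerivAt.comp (f := Prod.snd) (c n z, c n ξ) Complex.conjCLE.hasFDerivAt hasFDerivAt_snd
    have h3 : HasFDerivAt (gF p (dl n)) _ (c n z, c n ξ) := h1.mul h2
    simp only [ee_apply, map_zero]
    rw [h3.fderiv]
    simp
  have s1 := hm (η, 0)
  have s2 := (hm (Complex.I • η, 0)).mul_left Complex.I
  have s3 := (s1.add s2).div_const 2
  unfold dbar
  rw [e1, e1]
  refine s3.congr_fun ?_
  intro n
  rw [e2, e2, map_smul, smul_eq_mul]
  have := real_lin (fderiv ℝ (phiF p (dl n)) (c n z)) (c n η)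
  linear_combination (-(starRingEnd ℂ) (c n ξ) / 2) * this

lemma CoordHyp.closed (H : CoordHyp p c e) (hp : 2 ≤ p) : DbarClosed univ (FF p c) := by
  intro z _ ξ η
  refine (H.dbar_hasSum hp z ξ η).unique ((H.dbar_hasSum hp z η ξ).congr_fun ?_)
  intro n; ring

lemma young_aux (p : ℕ) (hp : 2 ≤ p) (a b : ℝ) (ha : 0 ≤ a) (hb : 0 ≤ b) :
    a ^ (p - 1) * b ≤ ((p - 1 : ℝ) / p) * a ^ p + (1 / p) * b ^ p := by
  have hp0 : (0 : ℝ) < p := by positivity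
  have hp1 : (2 : ℝ) ≤ p := by exact_mod_cast hp
  have := Real.geom_mean_le_arith_mean2_weighted (w₁ := (p - 1 : ℝ) / p) (w₂ := 1 / p)
    (p₁ := a ^ p) (p₂ := b ^ p) (div_nonneg (by linarith) hp0.le) (by positivity)
    (by positivity) (by positivity) (by field_simp; ring)
  refine le_trans (le_of_eq ?_) this
  congr 1
  · rw [← Real.rpow_natCast a p, ← Real.rpow_mul ha, mul_div_cancel₀ _ hp0.ne',
      ← Real.rpow_natCast a (p - 1), Nat.cast_sub (by omega)]
    simp
  · rw [← Real.rpow_natCast b p, ← Real.rpow_mul hb, mul_one_div_cancel hp0.ne', Real.rpow_one]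

lemma CoordHyp.bound (H : CoordHyp p c e) (hp : 2 ≤ p) (r : ℝ) (hr : 0 < r) (z : V)
    (hz : ‖z‖ < r) (ξ : V) (hξ : ‖ξ‖ ≤ 1) : ‖FF p c z ξ‖ ≤ r ^ (p - 1) := by
  have hp0 : (0 : ℝ) < p := by positivity
  have hp1 : (2 : ℝ) ≤ p := by exact_mod_cast hp
  have hs := (H.summ hp z ξ).hasSum
  refine le_of_tendsto (hs.norm) (Filter.Eventually.of_forall fun S => ?_)
  have h1 : ∀ n, ‖gF p (dl n) (c n z, c n ξ)‖ ≤ r ^ (p - 1) *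
      (((p - 1 : ℝ) / p) * ((‖c n z‖ ^ p) / r ^ p) + (1 / p) * ‖c n ξ‖ ^ p) := by
    intro n
    have hy := young_aux p hp (‖c n z‖ / r) ‖c n ξ‖ (by positivity) (norm_nonneg _)
    rw [div_pow, div_pow] at hy
    calc ‖gF p (dl n) (c n z, c n ξ)‖ ≤ ‖c n z‖ ^ (p - 1) * ‖c n ξ‖ := by
          simp only [gF, norm_mul, RCLike.norm_conj]
          gcongr
          exact phiF_norm p (by omega) _ _
      _ = r ^ (p - 1) * (‖c n z‖ ^ (p - 1) / r ^ (p - 1) * ‖c n ξ‖) := by field_simp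
      _ ≤ _ := by gcongr
  calc ‖∑ n ∈ S, gF p (dl n) (c n z, c n ξ)‖ ≤ ∑ n ∈ S, r ^ (p - 1) *
      (((p - 1 : ℝ) / p) * ((‖c n z‖ ^ p) / r ^ p) + (1 / p) * ‖c n ξ‖ ^ p) :=
        (norm_sum_le _ _).trans (Finset.sum_le_sum fun n _ => h1 n)
    _ = r ^ (p - 1) * (((p - 1 : ℝ) / p) * ((∑ n ∈ S, ‖c n z‖ ^ p) / r ^ p) +
          (1 / p) * ∑ n ∈ S, ‖c n ξ‖ ^ p) := by
        rw [← Finset.mul_sum, Finset.sum_add_distrib, ← Finset.mul_sum, ← Finset.mul_sum,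
          Finset.sum_div]
    _ ≤ r ^ (p - 1) * (((p - 1 : ℝ) / p) * 1 + (1 / p) * 1) := by
        have q1 : (∑ n ∈ S, ‖c n z‖ ^ p) / r ^ p ≤ 1 := by
          rw [div_le_one (by positivity)]
          exact (H.hc z S).trans (pow_le_pow_left₀ (norm_nonneg _) hz.le p)
        have q2 : ∑ n ∈ S, ‖c n ξ‖ ^ p ≤ 1 :=
          (H.hc ξ S).trans (pow_le_one₀ (norm_nonneg _) hξ)
        have q3 : 0 ≤ (p - 1 : ℝ) / p := div_nonneg (by linarith) hp0.le
        gcongr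
    _ = r ^ (p - 1) := by field_simp; ring

end

section
variable {V : Type*} [NormedAddCommGroup V] [NormedSpace ℂ V] {p : ℕ}
    {c : ℕ → V →L[ℂ] ℂ} {e : ℕ → V}

lemma CoordHyp.norm_e (H : CoordHyp p c e) (hp : 2 ≤ p) (n : ℕ) : ‖e n‖ = 1 := by
  have := H.hn n 0 1 (map_zero _)
  rw [zero_add, one_smul, norm_zero, zero_pow (by omega), zero_add, norm_one, one_pow] at this
  exact (pow_eq_one_iff_of_nonneg (norm_nonneg _) (by omega)).1 this

lemma CoordHyp.FF_line (H : CoordHyp p c e) (ν : ℕ) (x : V) (hx : c ν x = 0) (ζ : ℂ) :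
    FF p c (x + ζ • e ν) (e ν) = phiF p (dl ν) ζ := by
  rw [FF, tsum_eq_single ν]
  · simp [gF, H.he, hx]
  · intro n hn
    simp [gF, H.he, hn]

lemma CoordHyp.holo (H : CoordHyp p c e) (hp : 2 ≤ p) (ν : ℕ) (x : V) (hx : c ν x = 0)
    (u : V → ℂ) (ζ : ℂ) (hu : DifferentiableAt ℝ u (x + ζ • e ν))
    (hd : dbar u (x + ζ • e ν) (e ν) = FF p c (x + ζ • e ν) (e ν)) :
    DifferentiableAt ℂ (fun ζ => u (x + ζ • e ν) - UF p (dl ν) ζ) ζ := by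
  obtain ⟨h1, h2⟩ := UF_dbar p (by omega) (dl ν) (dl_pos ν) ζ
  let L : ℂ →L[ℝ] V := (ContinuousLinearMap.toSpanSingleton ℂ (e ν)).restrictScalars ℝ
  have hL : ∀ a, L a = a • e ν := fun a => rfl
  have h3 : HasFDerivAt (fun ζ : ℂ => x + ζ • e ν) L ζ := L.hasFDerivAt.const_add x
  have h4 : HasFDerivAt (fun ζ : ℂ => u (x + ζ • e ν)) _ ζ :=
    HasFDerivAt.comp (f := fun ζ : ℂ => x + ζ • e ν) ζ hu.hasFDerivAt h3
  have h5 := h4.sub h1.hasFDerivAt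
  have h6 : HasFDerivAt (fun ζ => u (x + ζ • e ν) - UF p (dl ν) ζ) _ ζ := h5
  refine differentiableAt_complex_iff_differentiableAt_real.2 ⟨h6.differentiableAt, ?_⟩
  rw [h6.fderiv]
  rw [H.FF_line ν x hx, ← h2, dbar] at hd
  simp only [_root_.sub_apply, ContinuousLinearMap.comp_apply, hL, one_smul,
    smul_eq_mul]
  linear_combination (-2 * Complex.I) * hd + (fderiv ℝ u (x + ζ • e ν) (Complex.I • e ν) -
    fderiv ℝ (UF p (dl ν)) ζ Complex.I) * Complex.I_sq

def CC (p : ℕ) (r M : ℝ) : ℝ :=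
  2 * (M + (r / 4) ^ p * (|Real.log ((r / 4) ^ 2)| + |Real.log ((r / 4) ^ 2 + 1)|)) / (r / 4) ^ p

lemma CoordHyp.step (H : CoordHyp p c e) (hp : 2 ≤ p) (u : V → ℂ) (z₀ : V) (r M : ℝ)
    (hr : 0 < r)
    (hu : ∀ z, ‖z - z₀‖ < r → DifferentiableAt ℝ u z ∧ ‖u z‖ ≤ M ∧
      ∀ ξ, dbar u z ξ = FF p c z ξ)
    (x : V) (hx : ‖x - z₀‖ < r / 2) (ν : ℕ) (hxν : c ν x = 0) (t : ℝ) (ht : 0 < t)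
    (htr : t ≤ r / 8) (hδ : dl ν ≤ t) :
    ∃ a : ℂ, ‖a‖ = t ∧
      (u (x + a • e ν)).re ≤ (u x).re + t ^ p * (Real.log (2 * t ^ 2) + CC p r M) := by
  set k : ℂ → ℂ := fun ζ => u (x + ζ • e ν) - UF p (dl ν) ζ with hk
  have hin : ∀ ζ : ℂ, ‖ζ‖ < r / 2 → ‖x + ζ • e ν - z₀‖ < r := by
    intro ζ hζ
    calc ‖x + ζ • e ν - z₀‖ = ‖(x - z₀) + ζ • e ν‖ := by congr 1; abel
      _ ≤ ‖x - z₀‖ + ‖ζ • e ν‖ := norm_add_le _ _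
      _ < r := by rw [norm_smul, H.norm_e hp, mul_one]; linarith
  have hkd : DifferentiableOn ℂ k (Metric.ball 0 (r / 2)) := by
    intro ζ hζ
    rw [mem_ball_zero_iff] at hζ
    obtain ⟨a1, a2, a3⟩ := hu _ (hin ζ hζ)
    exact (H.holo hp ν x hxν u ζ a1 (a3 _)).differentiableWithinAt
  have hδ0 := dl_pos ν
  have hδ1 := dl_le ν
  set M' : ℝ := M + (r / 4) ^ p * (|Real.log ((r / 4) ^ 2)| + |Real.log ((r / 4) ^ 2 + 1)|)
    with hM'
  have hkM : ∀ ζ ∈ Metric.sphere (0 : ℂ) (r / 4), ‖k ζ‖ ≤ M' := by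
    intro ζ hζ
    rw [mem_sphere_zero_iff_norm] at hζ
    obtain ⟨a1, a2, a3⟩ := hu _ (hin ζ (by linarith))
    refine (norm_sub_le _ _).trans (add_le_add a2 ?_)
    rw [UF, norm_mul, norm_pow, hζ, Complex.norm_real, Real.norm_eq_abs]
    gcongr
    have b1 : Real.log ((r / 4) ^ 2) ≤ Real.log ((r / 4) ^ 2 + dl ν ^ 2) :=
      Real.log_le_log (by positivity) (by nlinarith)
    have b2 : Real.log ((r / 4) ^ 2 + dl ν ^ 2) ≤ Real.log ((r / 4) ^ 2 + 1) :=
      Real.log_le_log (by positivity) (by nlinarith)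
    have b3 := neg_abs_le (Real.log ((r / 4) ^ 2))
    have b4 := le_abs_self (Real.log ((r / 4) ^ 2 + 1))
    have b5 := abs_nonneg (Real.log ((r / 4) ^ 2))
    have b6 := abs_nonneg (Real.log ((r / 4) ^ 2 + 1))
    exact abs_le.2 ⟨by linarith, by linarith⟩
  have hω := Complex.isPrimitiveRoot_exp p (by omega)
  set ω := Complex.exp (2 * Real.pi * Complex.I / p)
  have hω1 : ‖ω‖ = 1 := hω.norm'_eq_one (by omega)
  have key := taylor_avg p hp k (r / 2) (r / 4) M' t (by positivity) (by linarith) hkd hkM ht.le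
    (by linarith) ω hω
  have hk0 : k 0 = u x := by
    simp only [hk, zero_smul, add_zero, UF]
    rw [zero_pow (by omega)]; simp
  rw [hk0] at key
  have hre := (Complex.re_le_norm _).trans key
  rw [Complex.sub_re, Complex.re_sum] at hre
  have hre2 : ((p : ℂ) * u x).re = p * (u x).re := by simp
  rw [hre2] at hre
  obtain ⟨j, hj, hj2⟩ : ∃ j ∈ Finset.range p,
      (k (ω ^ j * t)).re ≤ (u x).re + 2 * M' * (t / (r / 4)) ^ p := by
    refine Finset.exists_le_of_sum_le ⟨0, Finset.mem_range.2 (by omega)⟩ ?_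
    rw [Finset.sum_const, Finset.card_range, nsmul_eq_mul]
    linarith
  have hn : ‖ω ^ j * (t : ℂ)‖ = t := by
    rw [norm_mul, norm_pow, hω1, one_pow, one_mul, Complex.norm_real, Real.norm_of_nonneg ht.le]
  refine ⟨ω ^ j * t, hn, ?_⟩
  have hU : UF p (dl ν) (ω ^ j * t) = ((t ^ p * Real.log (t ^ 2 + dl ν ^ 2) : ℝ) : ℂ) := by
    rw [UF, hn, mul_pow, ← pow_mul, mul_comm j p, pow_mul, hω.pow_eq_one, one_pow, one_mul]
    push_cast; rfl
  have hk2 : (k (ω ^ j * t)).re = (u (x + (ω ^ j * (t : ℂ)) • e ν)).re -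
      t ^ p * Real.log (t ^ 2 + dl ν ^ 2) := by
    simp only [hk]
    rw [hU, Complex.sub_re, Complex.ofReal_re]
  rw [hk2] at hj2
  have hlog : Real.log (t ^ 2 + dl ν ^ 2) ≤ Real.log (2 * t ^ 2) :=
    Real.log_le_log (by positivity) (by nlinarith)
  have hCC : 2 * M' * (t / (r / 4)) ^ p = t ^ p * CC p r M := by
    rw [CC, ← hM', div_pow]; field_simp
  rw [hCC] at hj2
  have := mul_le_mul_of_nonneg_left hlog (pow_nonneg ht.le p)
  rw [mul_add]
  linarith

lemma dl_small (t : ℝ) (ht : 0 < t) : ∃ N, ∀ n ≥ N, dl n ≤ t := by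
  have := tendsto_pow_atTop_nhds_zero_of_lt_one (r := (1 / 2 : ℝ)) (by norm_num) (by norm_num)
  exact Filter.eventually_atTop.1 ((this.eventually (gt_mem_nhds ht)).mono fun n hn => hn.le)

lemma CoordHyp.iter (H : CoordHyp p c e) (hp : 2 ≤ p) (u : V → ℂ) (z₀ : V) (r M : ℝ)
    (hr : 0 < r)
    (hu : ∀ z, ‖z - z₀‖ < r → DifferentiableAt ℝ u z ∧ ‖u z‖ ≤ M ∧
      ∀ ξ, dbar u z ξ = FF p c z ξ)
    (N₀ : ℕ) (hN₀ : ∀ n ≥ N₀, c n z₀ = 0) (t : ℝ) (ht : 0 < t)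
    (htr : t ≤ r / 8) (n : ℕ) (hn : n * t ^ p < (r / 2) ^ p) :
    ∃ x, (∃ N, ∀ n ≥ N, c n x = 0) ∧ ‖x - z₀‖ ^ p ≤ n * t ^ p ∧
      (u x).re ≤ M + n * t ^ p * (Real.log (2 * t ^ 2) + CC p r M) := by
  induction n with
  | zero =>
    refine ⟨z₀, ⟨N₀, hN₀⟩, ?_, ?_⟩
    · rw [sub_self, norm_zero, zero_pow (by omega)]; simp
    · have := (hu z₀ (by simpa using hr)).2.1
      have := Complex.re_le_norm (u z₀)
      simp only [Nat.cast_zero, zero_mul, add_zero]; linarith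
  | succ n ih =>
    push_cast at hn
    have htp : 0 < t ^ p := by positivity
    obtain ⟨x, ⟨N, hN⟩, h1, h2⟩ := ih (by nlinarith)
    obtain ⟨N', hN'⟩ := dl_small t ht
    set ν := max N₀ (max N N')
    have n1 : N₀ ≤ ν := le_max_left _ _
    have n2 : N ≤ ν := (le_max_left _ _).trans (le_max_right _ _)
    have n3 : N' ≤ ν := (le_max_right _ _).trans (le_max_right _ _)
    have hx : ‖x - z₀‖ < r / 2 :=
      lt_of_pow_lt_pow_left₀ p (by positivity) (by nlinarith)
    obtain ⟨a, ha, hle⟩ := H.step hp u z₀ r M hr hu x hx ν (hN ν n2) t ht htr (hN' ν n3)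
    refine ⟨x + a • e ν, ⟨ν + 1, fun m hm => ?_⟩, ?_, ?_⟩
    · have : m ≠ ν := by omega
      rw [map_add, map_smul, H.he, if_neg this, hN m (by omega)]; simp
    · rw [show x + a • e ν - z₀ = (x - z₀) + a • e ν by abel,
        H.hn ν _ _ (by rw [map_sub, hN ν n2, hN₀ ν n1, sub_zero]), ha]
      push_cast; linarith
    · push_cast; linarith

lemma CoordHyp.nosol (H : CoordHyp p c e) (hp : 2 ≤ p) (Ω : Set V) (hΩ : IsOpen Ω)
    (hne : Ω.Nonempty) (u : V → ℂ) (hu : ContDiffOn ℝ 1 u Ω)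
    (hd : ∀ z ∈ Ω, ∀ ξ, dbar u z ξ = FF p c z ξ) : False := by
  obtain ⟨z₁, hz₁⟩ := hne
  obtain ⟨ε, hε, hball⟩ := Metric.isOpen_iff.1 hΩ z₁ hz₁
  obtain ⟨z₀, hz₀, N₀, hN₀⟩ := H.hd z₁ ε hε
  have hz₀Ω : z₀ ∈ Ω := hball (by rwa [mem_ball_iff_norm])
  have hdiff : ∀ z ∈ Ω, DifferentiableAt ℝ u z := fun z hz =>
    (hu.differentiableOn (by simp)).differentiableAt (hΩ.mem_nhds hz)
  have hev : ∀ᶠ z in nhds z₀, z ∈ Ω ∧ ‖u z‖ ≤ ‖u z₀‖ + 1 := by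
    refine (hΩ.eventually_mem hz₀Ω).and ?_
    refine ((hdiff z₀ hz₀Ω).continuousAt.norm.eventually
      (gt_mem_nhds (lt_add_one ‖u z₀‖))).mono fun z hz => hz.le
  obtain ⟨r, hr, hrb⟩ := Metric.eventually_nhds_iff.1 hev
  set M := ‖u z₀‖ + 1 with hM
  have hM0 : 0 < M := by positivity
  have hu' : ∀ z, ‖z - z₀‖ < r → DifferentiableAt ℝ u z ∧ ‖u z‖ ≤ M ∧
      ∀ ξ, dbar u z ξ = FF p c z ξ := by
    intro z hz
    obtain ⟨a, b⟩ := hrb (by rwa [dist_eq_norm] : dist z z₀ < r)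
    exact ⟨hdiff z a, b, hd z a⟩
  set K := (r / 2) ^ p with hK
  have hK0 : 0 < K := by positivity
  set A : ℝ := -(12 * M + 4) / K - CC p r M - Real.log 2 with hA
  obtain ⟨t, ⟨htA, htr⟩, ht⟩ : ∃ t : ℝ, (Real.log t ≤ A / 2 ∧ t ≤ r / 8) ∧ 0 < t := by
    have h1 := Real.tendsto_log_nhdsGT_zero.eventually (Filter.eventually_le_atBot (A / 2))
    have h2 : ∀ᶠ t : ℝ in nhdsWithin 0 (Ioi 0), t ≤ r / 8 :=
      nhdsWithin_le_nhds ((gt_mem_nhds (show (0 : ℝ) < r / 8 by positivity)).mono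
        fun x hx => hx.le)
    exact ((h1.and h2).and self_mem_nhdsWithin).exists
  have htp : 0 < t ^ p := by positivity
  have htp2 : t ^ p ≤ K / 4 := by
    have h4 : (4 : ℝ) ≤ 4 ^ p := by
      calc (4 : ℝ) = 4 ^ 1 := by norm_num
        _ ≤ 4 ^ p := pow_le_pow_right₀ (by norm_num) (by omega)
    have : (4 * t) ^ p ≤ K := pow_le_pow_left₀ (by positivity) (by linarith) p
    rw [mul_pow] at this
    nlinarith
  set n := ⌊K / (2 * t ^ p)⌋₊ with hn
  have hn1 : n * t ^ p ≤ K / 2 := by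
    have : (n : ℝ) ≤ K / (2 * t ^ p) := Nat.floor_le (by positivity)
    rw [le_div_iff₀ (by positivity)] at this
    linarith
  have hn2 : K / 4 ≤ n * t ^ p := by
    have : K / (2 * t ^ p) < n + 1 := Nat.lt_floor_add_one _
    rw [div_lt_iff₀ (by positivity)] at this
    linarith
  obtain ⟨x, -, hx1, hx2⟩ := H.iter hp u z₀ r M hr hu' N₀ hN₀ t ht htr n (by linarith)
  have hx3 : ‖x - z₀‖ < r := by
    have : ‖x - z₀‖ < r / 2 := lt_of_pow_lt_pow_left₀ p (by positivity) (by linarith)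
    linarith
  have hx4 := (hu' x hx3).2.1
  have hx5 : -M ≤ (u x).re := by
    have := Complex.abs_re_le_norm (u x)
    have := neg_abs_le (u x).re
    linarith
  have hlog : Real.log (2 * t ^ 2) + CC p r M ≤ -(12 * M + 4) / K := by
    rw [Real.log_mul (by norm_num) (by positivity), Real.log_pow]
    push_cast
    linarith
  have hneg : -(12 * M + 4) / K < 0 := div_neg_of_neg_of_pos (by linarith) hK0
  have h7 : n * t ^ p * (Real.log (2 * t ^ 2) + CC p r M) ≤ K / 4 * (-(12 * M + 4) / K) := by
    nlinarith
  have h8 : K / 4 * (-(12 * M + 4) / K) = -(3 * M + 1) := by field_simp; ring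
  linarith

end

lemma lp_coord (p : ℕ) (hp : 2 ≤ p) [Fact (1 ≤ (p : ℝ≥0∞))] :
    CoordHyp (V := Lp' p) p (fun n => lp.evalCLM ℂ (fun _ : ℕ => ℂ) (p : ℝ≥0∞) n)
      (fun n => lp.single (E := fun _ : ℕ => ℂ) (p : ℝ≥0∞) n 1) := by
  have hpr : ((p : ℝ≥0∞)).toReal = p := ENNReal.toReal_natCast p
  have hp0 : 0 < ((p : ℝ≥0∞)).toReal := by rw [hpr]; positivity
  have hev : ∀ n (v : Lp' p), lp.evalCLM ℂ (fun _ : ℕ => ℂ) (p : ℝ≥0∞) n v = v n :=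
    fun n v => rfl
  refine ⟨?_, ?_, ?_, ?_⟩
  · intro v S
    have := lp.sum_rpow_le_norm_rpow hp0 v S
    simp only [hpr, Real.rpow_natCast] at this
    exact this
  · intro n m
    rw [hev, lp.single_apply, Pi.single_apply]
  · intro n v a hv
    rw [hev] at hv
    have e1 : (a • lp.single (E := fun _ : ℕ => ℂ) (p : ℝ≥0∞) n 1 : Lp' p) =
        lp.single (E := fun _ : ℕ => ℂ) (p : ℝ≥0∞) n a := by
      rw [← lp.single_smul]; simp
    rw [e1]
    have := lp.norm_sub_norm_compl_sub_single hp0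
      (v + lp.single (E := fun _ : ℕ => ℂ) (p : ℝ≥0∞) n a) {n}
    have e2 : (v + lp.single (E := fun _ : ℕ => ℂ) (p : ℝ≥0∞) n a) n = a := by
      rw [lp.coeFn_add, Pi.add_apply, hv, lp.single_apply_self, zero_add]
    rw [Finset.sum_singleton, Finset.sum_singleton, e2, add_sub_cancel_right] at this
    simp only [hpr, Real.rpow_natCast] at this
    linarith
  · intro v ε hε
    have h := (lp.hasSum_single (ENNReal.natCast_ne_top p) v)
    obtain ⟨S, hS⟩ := (h.eventually (Metric.ball_mem_nhds v hε)).exists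
    refine ⟨_, by rwa [← mem_ball_iff_norm], S.sup id + 1, fun n hn => ?_⟩
    rw [map_sum]
    refine Finset.sum_eq_zero fun i hi => ?_
    have : i ≤ S.sup id := Finset.le_sup (f := id) hi
    rw [hev, lp.single_apply_ne _ _ _ (by omega)]

/-- For any integer `p ≥ 2` there is a `∂̄`-closed `(0,1)`-form `f` of class
`C^{p−1}` on `l^p` with `|f|_{0,B(r)} ≤ r^{p−1}` for every `r > 0`, such that on no nonempty
open set `Ω ⊆ l^p` is there a continuously differentiable `u` with `∂̄u = f` on `Ω`. -/
theorem statement16 (p : ℕ) (hp : 2 ≤ p) [Fact (1 ≤ (p : ℝ≥0∞))] :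
    ∃ f : Lp' p → Lp' p → ℂ,
      IsForm01 (p - 1) (univ : Set (Lp' p)) f ∧
      DbarClosed (univ : Set (Lp' p)) f ∧
      (∀ r : ℝ, 0 < r → ∀ z : Lp' p, ‖z‖ < r → ∀ ξ : Lp' p, ‖ξ‖ ≤ 1 →
        ‖f z ξ‖ ≤ r ^ (p - 1)) ∧
      ∀ Ω : Set (Lp' p), IsOpen Ω → Ω.Nonempty →
        ¬∃ u : Lp' p → ℂ,
          ContDiffOn ℝ 1 u Ω ∧ ∀ z ∈ Ω, ∀ ξ : Lp' p, dbar u z ξ = f z ξ := by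
  have H := lp_coord p hp
  refine ⟨_, H.form hp, H.closed hp, H.bound hp, ?_⟩
  rintro Ω hΩ hne ⟨u, hu, hd⟩
  exact H.nosol hp Ω hΩ hne u hu hd
end
end

section
/- Let p ≥ 1 be an integer and let φ : ℂ → ℂ be a compactly supported function of class C^{p−1} (in the real sense) with |φ(ζ)| ≤ |ζ|^{p−1} for all ζ ∈ ℂ. Then for all z, ξ ∈ l^p the series ∑_{ν=1}^∞ φ(z_ν)·conj(ξ_ν) converges absolutely; setting f(z)(ξ) equal to its sum defines a (0,1)-form f of class C^{p−1} on l^p; |f|_{0,B(r)} ≤ r^{p−1} for every r > 0; and if p ≥ 2 then f is ∂̄-closed. -/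
open Set
open scoped ENNReal NNReal

noncomputable section

lemma weights (n : ℕ) : ∃ w : Fin (n+2) → ℝ, ∀ j : Fin (n+2),
    ∑ i, w i * ((i : ℕ) : ℝ) ^ (j : ℕ) = if j = 1 then 1 else 0 := by
  let A : Matrix (Fin (n+2)) (Fin (n+2)) ℝ := Matrix.vandermonde (fun i => ((i : ℕ) : ℝ))
  have hA : IsUnit A.det := by
    rw [isUnit_iff_ne_zero]
    refine Matrix.det_vandermonde_ne_zero_iff.2 ?_
    intro a b h
    have h' : ((a:ℕ):ℝ) = ((b:ℕ):ℝ) := h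
    exact Fin.ext (by exact_mod_cast h')
  refine ⟨fun i => A⁻¹ 1 i, fun j => ?_⟩
  have h := Matrix.nonsing_inv_mul A hA
  have h2 := congrFun (congrFun h 1) j
  rw [Matrix.mul_apply, Matrix.one_apply] at h2
  simp only [A, Matrix.vandermonde_apply] at h2
  rw [show (if j = 1 then (1:ℝ) else 0) = if 1 = j then 1 else 0 by simp [eq_comm]]
  exact h2

lemma landau (n : ℕ) : ∃ w : Fin (n+2) → ℝ, ∃ K : ℝ, 0 ≤ K ∧
    ∀ (F : Type) [NormedAddCommGroup F] [NormedSpace ℝ F] (v : ℝ → F) (M : ℝ),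
    ContDiff ℝ (n+2 : ℕ) v → (∀ y, ‖iteratedDeriv (n+2) v y‖ ≤ M) →
    ‖∑ i, w i • v ((i : ℕ) : ℝ) - deriv v 0‖ ≤ K * M := by
  obtain ⟨w, hw⟩ := weights n
  refine ⟨w, ∑ i, |w i| * (((i:ℕ) : ℝ) ^ (n+2) / (n+1).factorial), by positivity, ?_⟩
  intro F _ _ v M hv hM
  set S : Set ℝ := Icc 0 ((n:ℝ)+2)
  have hS : UniqueDiffOn ℝ S := uniqueDiffOn_Icc (by positivity)
  have h0 : (0:ℝ) ∈ S := ⟨le_rfl, by positivity⟩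
  have key : ∑ i : Fin (n+2), w i • taylorWithinEval v (n+1) S 0 ((i:ℕ):ℝ) = deriv v 0 := by
    simp only [taylor_within_apply, sub_zero, Finset.smul_sum]
    rw [Finset.sum_comm]
    have : ∀ j ∈ Finset.range (n+1+1), ∑ i : Fin (n+2), w i • (((j.factorial:ℝ)⁻¹ * ((i:ℕ):ℝ)^j) •
        iteratedDerivWithin j v S 0) = if j = 1 then deriv v 0 else 0 := by
      intro j hj
      have hj' : j < n+2 := by have := Finset.mem_range.1 hj; omega
      have h1 := hw ⟨j, hj'⟩
      have : ∀ i : Fin (n+2), w i • (((j.factorial:ℝ)⁻¹ * ((i:ℕ):ℝ)^j) •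
        iteratedDerivWithin j v S 0) = (w i * ((i:ℕ):ℝ)^j) • ((j.factorial:ℝ)⁻¹ • 
        iteratedDerivWithin j v S 0) := by
        intro i
        simp only [smul_smul]
        congr 1; ring
      simp only [this]
      rw [← Finset.sum_smul, h1]
      by_cases hj1 : j = 1
      · subst hj1
        have : (⟨1, hj'⟩ : Fin (n+2)) = 1 := by ext; simp
        rw [if_pos this, if_pos rfl]
        rw [iteratedDerivWithin_one, derivWithin]
        · simp only [Nat.factorial_one, Nat.cast_one, inv_one, one_smul]
          rw [fderivWithin_eq_fderiv (hS 0 h0) (hv.differentiable (by simp) 0)]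
          rfl
      · rw [if_neg hj1, if_neg, zero_smul]
        intro h
        apply hj1
        have := congrArg Fin.val h
        simpa using this
    rw [Finset.sum_congr rfl this]
    simp
  rw [← key, ← Finset.sum_sub_distrib, Finset.sum_mul]
  refine norm_sum_le_of_le _ fun i _ => ?_
  rw [← smul_sub, norm_smul, Real.norm_eq_abs, mul_assoc]
  gcongr
  have hi : ((i:ℕ):ℝ) ∈ S := by
    refine ⟨by positivity, ?_⟩
    have := i.2
    have : ((i:ℕ):ℝ) ≤ (n+2 : ℕ) := by exact_mod_cast this.le
    simpa using this
  have := taylor_mean_remainder_bound (f := v) (a := 0) (b := (n:ℝ)+2) (C := M) (n := n+1) 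
    (by positivity) (by exact_mod_cast hv.contDiffOn) hi (by
      intro y hy
      rw [iteratedDerivWithin_eq_iteratedDeriv hS (hv.contDiffAt) hy]
      exact hM y)
  refine this.trans (le_of_eq ?_)
  rw [sub_zero]; ring

lemma line_bound {F : Type} [NormedAddCommGroup F] [NormedSpace ℝ F] (g : ℂ → F) (k : ℕ)
    (hg : ContDiff ℝ k g) (M : ℝ) (hM : ∀ x, ‖iteratedFDeriv ℝ k g x‖ ≤ M) (a e : ℂ) (y : ℝ) :
    ‖iteratedDeriv k (fun s : ℝ => g (a + s • e)) y‖ ≤ M * ‖e‖ ^ k := by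
  rw [← norm_iteratedFDeriv_eq_norm_iteratedDeriv]
  have : (fun s : ℝ => g (a + s • e)) =
    (fun x => g (a + x)) ∘ (ContinuousLinearMap.toSpanSingleton ℝ e) := by
    ext s; simp
  rw [this, ContinuousLinearMap.iteratedFDeriv_comp_right (n := k) _ (by fun_prop) _ le_rfl]
  refine (ContinuousMultilinearMap.norm_compContinuousLinearMap_le _ _).trans ?_
  simp only [Finset.prod_const, Finset.card_univ, Fintype.card_fin, iteratedFDeriv_comp_add_left,
    ContinuousLinearMap.norm_toSpanSingleton]
  gcongr
  exact hM _

lemma deriv_decay {F : Type} [NormedAddCommGroup F] [NormedSpace ℝ F] (g : ℂ → F) (k : ℕ)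
    (hg : ContDiff ℝ (k+1 : ℕ) g) (hs : HasCompactSupport g) (C : ℝ)
    (hC : ∀ x, ‖g x‖ ≤ C * ‖x‖ ^ (k+1)) : ∃ C', ∀ x, ‖fderiv ℝ g x‖ ≤ C' * ‖x‖ ^ k := by
  rcases k with _ | n
  · obtain ⟨M, hM⟩ := (hs.fderiv (𝕜 := ℝ)).exists_bound_of_continuous
      (hg.continuous_fderiv (by simp))
    exact ⟨M, by simpa using hM⟩
  have hC0 : 0 ≤ C := by
    have := (norm_nonneg _).trans (hC 1)
    simpa using this
  obtain ⟨M, hM⟩ := (hs.iteratedFDeriv (𝕜 := ℝ) (n+2)).exists_bound_of_continuous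
    (hg.continuous_iteratedFDeriv le_rfl)
  have hM0 : 0 ≤ M := (norm_nonneg _).trans (hM 0)
  obtain ⟨w, K, hK, hl⟩ := landau n
  set C' := ∑ i : Fin (n+2), |w i| * (C * (1 + ((i:ℕ):ℝ))^(n+2)) + K * M with hC'
  have hC'0 : 0 ≤ C' := by positivity
  have main : ∀ x e : ℂ, ‖e‖ = ‖x‖ → ‖fderiv ℝ g x e‖ ≤ C' * ‖x‖^(n+2) := by
    intro x e he
    have hv : ContDiff ℝ (n+2:ℕ) (fun s : ℝ => g (x + s • e)) := by
      have : ContDiff ℝ (n+2:ℕ) g := hg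
      fun_prop
    have h1 := hl F (fun s : ℝ => g (x + s • e)) (M * ‖e‖^(n+2)) hv
      (fun y => line_bound g _ hg M hM x e y)
    have hd : deriv (fun s : ℝ => g (x + s • e)) 0 = fderiv ℝ g x e := by
      have : HasFDerivAt g (fderiv ℝ g x) (x + (0:ℝ) • e) := by
        simpa using (hg.differentiable (by simp) x).hasFDerivAt
      have h2 : HasDerivAt (fun s : ℝ => x + s • e) e 0 := by
        simpa using ((hasDerivAt_id (0:ℝ)).smul_const e).const_add x
      exact (this.comp_hasDerivAt 0 h2).deriv
    rw [hd] at h1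
    have h3 : ‖∑ i : Fin (n+2), w i • g (x + ((i:ℕ):ℝ) • e)‖ ≤
        ∑ i : Fin (n+2), |w i| * (C * (1 + ((i:ℕ):ℝ))^(n+2)) * ‖x‖^(n+2) := by
      refine norm_sum_le_of_le _ fun i _ => ?_
      rw [norm_smul, Real.norm_eq_abs, mul_assoc]
      gcongr
      refine (hC _).trans ?_
      rw [mul_assoc, ← mul_pow]
      gcongr
      refine (norm_add_le _ _).trans ?_
      rw [norm_smul, he]
      simp [add_mul]
    have h4 := norm_sub_norm_le (fderiv ℝ g x e) (∑ i : Fin (n+2), w i • g (x + ((i:ℕ):ℝ) • e))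
    rw [norm_sub_rev] at h4
    rw [hC', add_mul, Finset.sum_mul]
    rw [he] at h1
    linarith
  refine ⟨C', fun x => ?_⟩
  by_cases hx : x = 0
  · have hz : HasFDerivAt g (0 : ℂ →L[ℝ] F) 0 := by
      have hg0 : g 0 = 0 := by
        have := hC 0
        simpa using this
      rw [hasFDerivAt_iff_isLittleO_nhds_zero]
      simp only [zero_add, hg0, sub_zero, _root_.zero_apply]
      have h1 : g =O[nhds 0] (fun x : ℂ => ‖x‖^(n+2)) :=
        Asymptotics.IsBigO.of_bound C (Filter.Eventually.of_forall fun x => by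
          simpa using hC x)
      refine h1.trans_isLittleO ?_
      have := Asymptotics.isLittleO_norm_pow_id (E' := ℂ) (n := n+2) (by omega)
      exact this
    subst hx
    rw [hz.fderiv]
    simp only [norm_zero]
    positivity
  · have hx' : 0 < ‖x‖ := norm_pos_iff.2 hx
    refine ContinuousLinearMap.opNorm_le_bound _ (by positivity) fun e => ?_
    by_cases he : e = 0
    · simp [he]
    have he' : 0 < ‖e‖ := norm_pos_iff.2 he
    have := main x ((‖x‖/‖e‖) • e) (by rw [norm_smul]; simp; field_simp)
    rw [map_smul, norm_smul] at this
    simp only [norm_div, norm_norm] at this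
    have h5 : ‖fderiv ℝ g x e‖ = (‖e‖/‖x‖) * (‖x‖/‖e‖ * ‖fderiv ℝ g x e‖) := by field_simp
    rw [h5]
    calc _ ≤ (‖e‖/‖x‖) * (C' * ‖x‖^(n+2)) := by gcongr
      _ = _ := by field_simp; ring

lemma mem_bound {F : Type} [NormedAddCommGroup F] (p k : ℕ) (hp : 1 ≤ p)
    (q : ℝ≥0∞) (hq : q = p / k) (g : ℂ → F) (C : ℝ) (hC : ∀ x, ‖g x‖ ≤ C * ‖x‖ ^ k)
    (z : lp (fun _ : ℕ => ℂ) p) : ∃ h : Memℓp (fun ν => g (z ν)) q,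
    ‖(⟨fun ν => g (z ν), h⟩ : lp (fun _ : ℕ => F) q)‖ ≤ C * ‖z‖ ^ k := by
  have hC0 : 0 ≤ C := by
    have := (norm_nonneg _).trans (hC 1)
    simpa using this
  have hz0 : 0 ≤ ‖z‖ := lp.norm_nonneg' z
  rcases k with _ | k
  · have : q = ∞ := by
      rw [hq]; simp only [Nat.cast_zero]
      rw [ENNReal.div_zero]; simp; omega
    subst this
    have h : Memℓp (fun ν => g (z ν)) ∞ := memℓp_infty ⟨C, by
      rintro _ ⟨i, rfl⟩
      simpa using hC (z i)⟩
    refine ⟨h, lp.norm_le_of_forall_le (by positivity) fun i => ?_⟩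
    simpa using hC (z i)
  have hp0 : (0:ℝ) < p := by exact_mod_cast hp
  have hk0 : (0:ℝ) < ((k+1 : ℕ) : ℝ) := by positivity
  have hqr : q.toReal = (p:ℝ) / ((k+1:ℕ):ℝ) := by
    rw [hq, ENNReal.toReal_div]; simp only [ENNReal.toReal_natCast]
  have hq0 : 0 < q.toReal := by rw [hqr]; positivity
  have hpr : ((p:ℝ≥0∞)).toReal = p := by simp
  have hpow : ∀ x : ℝ, 0 ≤ x → (C * x ^ (k+1)) ^ q.toReal = C ^ q.toReal * x ^ (p : ℝ) := by
    intro x hx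
    rw [Real.mul_rpow hC0 (by positivity), ← Real.rpow_natCast, ← Real.rpow_mul hx, hqr]
    congr 2
    field_simp
  have hsum : ∀ s : Finset ℕ, ∑ i ∈ s, ‖g (z i)‖ ^ q.toReal ≤ (C * ‖z‖^(k+1)) ^ q.toReal := by
    intro s
    rw [hpow _ hz0]
    have h1 := lp.sum_rpow_le_norm_rpow (p := (p:ℝ≥0∞)) (by rw [hpr]; exact hp0) z s
    rw [hpr] at h1
    calc _ ≤ ∑ i ∈ s, C ^ q.toReal * ‖z i‖ ^ (p:ℝ) := by
          refine Finset.sum_le_sum fun i _ => ?_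
          rw [← hpow _ (norm_nonneg _)]
          exact Real.rpow_le_rpow (norm_nonneg _) (hC _) hq0.le
      _ = C ^ q.toReal * ∑ i ∈ s, ‖z i‖ ^ (p:ℝ) := by rw [Finset.mul_sum]
      _ ≤ _ := by gcongr
  exact ⟨memℓp_gen' hsum, lp.norm_le_of_forall_sum_le hq0 (by positivity) hsum⟩

lemma holder_triple (p k : ℕ) (hp : 1 ≤ p) :
    ENNReal.HolderTriple ((p:ℝ≥0∞) / (k:ℕ)) p ((p:ℝ≥0∞) / ((k+1 : ℕ))) := by
  have h0 : (p:ℝ≥0∞) ≠ 0 := by simp; omega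
  refine ⟨?_⟩
  rw [ENNReal.inv_div (Or.inr (by simp)) (Or.inr h0), ENNReal.inv_div (Or.inr (by simp)) (Or.inr h0)]
  rw [← one_div, ← ENNReal.add_div]
  push_cast
  rfl

lemma fact_div (p k : ℕ) (hp : 1 ≤ p) (hk : k ≤ p) : Fact (1 ≤ (p:ℝ≥0∞) / (k:ℕ)) := by
  refine ⟨?_⟩
  rcases Nat.eq_zero_or_pos k with rfl | h
  · simp only [Nat.cast_zero]
    rw [ENNReal.div_zero]
    · simp
    · simp; omega
  rw [ENNReal.le_div_iff_mul_le (Or.inl (by simp; omega)) (Or.inl (by simp)), one_mul]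
  exact_mod_cast hk

/-- pointwise Hoelder bound -/
lemma holder_norm {E F G : Type} [NormedAddCommGroup E] [NormedAddCommGroup F]
    [NormedAddCommGroup G] (q p r : ℝ≥0∞) [Fact (1 ≤ q)] [Fact (1 ≤ p)] [Fact (1 ≤ r)]
    [q.HolderTriple p r] (a : lp (fun _ : ℕ => E) q) (b : lp (fun _ : ℕ => F) p)
    (c : lp (fun _ : ℕ => G) r) (h : ∀ i, ‖c i‖ ≤ ‖a i‖ * ‖b i‖) : ‖c‖ ≤ ‖a‖ * ‖b‖ := by
  have hB : ∀ i : ℕ, ‖ContinuousLinearMap.mul ℝ ℝ‖ ≤ ((1:ℝ≥0):ℝ) := by simp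
  let T := lp.holderL (ι := ℕ) (p := q) (q := p) r (fun _ => ContinuousLinearMap.mul ℝ ℝ) hB
  have h1 : ‖c‖ ≤ ‖T (lp.toNorm a) (lp.toNorm b)‖ := by
    refine lp.norm_mono (zero_lt_one.trans_le Fact.out).ne' fun i => ?_
    refine (h i).trans (le_of_eq ?_)
    change _ = ‖‖a i‖ * ‖b i‖‖
    simp
  refine h1.trans ?_
  refine (T.le_opNorm₂ _ _).trans ?_
  rw [lp.norm_toNorm, lp.norm_toNorm]
  have : ‖T‖ ≤ 1 := lp.norm_holderL_le r _ hB
  calc _ ≤ 1 * ‖a‖ * ‖b‖ := by gcongr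
    _ = _ := by ring

lemma mvt_pt {F : Type} [NormedAddCommGroup F] [NormedSpace ℝ F] (g : ℂ → F)
    (hg : ContDiff ℝ 1 g) (a b : ℂ) : ∃ c : ℂ, ‖c - a‖ ≤ ‖b - a‖ ∧
      ‖g b - g a - fderiv ℝ g a (b - a)‖ ≤ ‖fderiv ℝ g c - fderiv ℝ g a‖ * ‖b - a‖ := by
  have hc : Continuous (fun x => ‖fderiv ℝ g x - fderiv ℝ g a‖) := by
    have := hg.continuous_fderiv (by simp)
    fun_prop
  have hcomp : IsCompact (Metric.closedBall a ‖b - a‖) := isCompact_closedBall _ _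
  obtain ⟨c, hcm, hmax⟩ := hcomp.exists_isMaxOn ⟨a, by simp⟩ hc.continuousOn
  refine ⟨c, by simpa [dist_eq_norm] using hcm, ?_⟩
  exact (convex_closedBall a ‖b-a‖).norm_image_sub_le_of_norm_fderiv_le'
    (fun x _ => hg.differentiable (by simp) x) (fun x hx => hmax hx) (by simp)
    (by simp [dist_eq_norm])

lemma nem (p : ℕ) (hp : 1 ≤ p) [Fact (1 ≤ (p:ℝ≥0∞))] (k : ℕ) (hk : k ≤ p) :
    ∀ (F : Type) [NormedAddCommGroup F] [NormedSpace ℝ F] (q : ℝ≥0∞) [Fact (1 ≤ q)]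
      (_ : q = p / k) (g : ℂ → F) (_ : ContDiff ℝ k g) (_ : HasCompactSupport g) (C : ℝ)
      (_ : ∀ x, ‖g x‖ ≤ C * ‖x‖ ^ k),
      ∃ N : lp (fun _ : ℕ => ℂ) p → lp (fun _ : ℕ => F) q,
        (∀ z ν, N z ν = g (z ν)) ∧ (∀ z, ‖N z‖ ≤ C * ‖z‖ ^ k) ∧ ContDiff ℝ k N := by
  induction k with
  | zero =>
    intro F _ _ q _ hq g hg hs C hC
    choose hm hn using mem_bound p 0 hp q hq g C hC
    refine ⟨fun z => ⟨fun ν => g (z ν), hm z⟩, fun _ _ => rfl, hn, ?_⟩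
    have hq' : q = ∞ := by
      rw [hq]; simp only [Nat.cast_zero]
      rw [ENNReal.div_zero]; simp; omega
    subst hq'
    simp only [Nat.cast_zero, contDiff_zero]
    have hu : UniformContinuous g := hs.uniformContinuous_of_continuous hg.continuous
    rw [Metric.continuous_iff]
    intro z ε hε
    obtain ⟨δ, hδ, hu⟩ := Metric.uniformContinuous_iff.1 hu (ε/2) (by positivity)
    refine ⟨δ, hδ, fun w hw => ?_⟩
    rw [dist_eq_norm] at hw ⊢
    refine lt_of_le_of_lt (lp.norm_le_of_forall_le (C := ε/2) (by positivity) fun i => ?_)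
      (by linarith)
    have h1 : ‖w i - z i‖ ≤ ‖w - z‖ :=
      lp.norm_apply_le_norm (by simp; omega) (w - z) i
    have := hu (a := w i) (b := z i) (by rw [dist_eq_norm]; linarith)
    rw [dist_eq_norm] at this
    exact this.le
  | succ k ih =>
    intro F _ _ q _ hq g hg hs C hC
    choose hm hn using mem_bound p (k+1) hp q hq g C hC
    refine ⟨fun z => ⟨fun ν => g (z ν), hm z⟩, fun _ _ => rfl, hn, ?_⟩
    obtain ⟨C', hC'⟩ := deriv_decay g k hg hs C hC
    have := fact_div p k hp (by omega)
    have hht : ENNReal.HolderTriple ((p:ℝ≥0∞) / (k:ℕ)) p q := hq ▸ holder_triple p k hp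
    obtain ⟨N1, hN1, -, hN1c⟩ := ih (by omega) (ℂ →L[ℝ] F) (p / (k:ℕ)) rfl (fderiv ℝ g)
      (hg.fderiv_right (by push_cast; rfl)) (hs.fderiv (𝕜 := ℝ)) C' hC'
    have hB : ∀ i : ℕ, ‖ContinuousLinearMap.id ℝ (ℂ →L[ℝ] F)‖ ≤ ((1:ℝ≥0):ℝ) := by
      intro i
      simpa using ContinuousLinearMap.norm_id_le
    let L := lp.holderL (ι := ℕ) (p := (p:ℝ≥0∞)/(k:ℕ)) (q := (p:ℝ≥0∞)) q
      (fun _ => ContinuousLinearMap.id ℝ (ℂ →L[ℝ] F)) hB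
    push_cast
    rw [contDiff_succ_iff_hasFDerivAt]
    refine ⟨fun z => L (N1 z), L.contDiff.comp hN1c, fun z => ?_⟩
    rw [hasFDerivAt_iff_isLittleO, Asymptotics.isLittleO_iff]
    intro ε hε
    obtain ⟨δ, hδ, hcont⟩ := Metric.continuous_iff.1 hN1c.continuous z ε hε
    filter_upwards [Metric.ball_mem_nhds z hδ] with w hw
    rw [Metric.mem_ball, dist_eq_norm] at hw
    choose c hc1 hc2 using fun ν => mvt_pt g (hg.of_le (by exact_mod_cast Nat.le_add_left 1 k))
      (z ν) (w ν)
    have hdm : Memℓp (fun ν => c ν - z ν) p := Memℓp.mono' (lp.memℓp (w - z)) hc1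
    let d : lp (fun _ : ℕ => ℂ) p := ⟨fun ν => c ν - z ν, hdm⟩
    have hd : ‖d‖ ≤ ‖w - z‖ := lp.norm_mono (by simp; omega) hc1
    have hzd : ∀ ν, (z + d) ν = c ν := by
      intro ν
      change z ν + (c ν - z ν) = c ν
      ring
    have h1 : ‖N1 (z + d) - N1 z‖ < ε := by
      have := hcont (z + d) (by rw [dist_eq_norm]; simpa using lt_of_le_of_lt hd hw)
      rwa [dist_eq_norm] at this
    refine (holder_norm ((p:ℝ≥0∞)/(k:ℕ)) p q (N1 (z+d) - N1 z) (w - z) _ ?_).trans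
      (by gcongr)
    intro i
    change ‖g (w i) - g (z i) - (N1 z i) (w i - z i)‖ ≤ ‖N1 (z+d) i - N1 z i‖ * ‖w i - z i‖
    rw [hN1, hN1, hzd]
    exact hc2 i

lemma inst_eq (p : ℕ) [Fact (1 ≤ (p:ℝ≥0∞))] :
    (NormedSpace.complexToReal : NormedSpace ℝ (Lp' p)) = lp.instNormedSpace := by
  ext r x ν
  change (r:ℂ) * x ν = r • (x ν)
  simp

/-- the conjugate pairing -/
def Bconj : ℂ →L[ℝ] ℂ →L[ℝ] ℂ :=
  (ContinuousLinearMap.mul ℝ ℂ).bilinearComp (ContinuousLinearMap.id ℝ ℂ)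
    (Complex.conjCLE : ℂ →L[ℝ] ℂ)

lemma Bconj_apply (a b : ℂ) : Bconj a b = a * (starRingEnd ℂ) b := rfl

lemma Bconj_norm : ‖Bconj‖ ≤ ((1:ℝ≥0):ℝ) := by
  refine ContinuousLinearMap.opNorm_le_bound₂ _ (by simp) fun a b => ?_
  rw [Bconj_apply]
  simp

lemma core (p : ℕ) (hp : 1 ≤ p) [Fact (1 ≤ (p : ℝ≥0∞))]
    (φ : ℂ → ℂ) (hsupp : HasCompactSupport φ) (hsm : ContDiff ℝ ((p - 1 : ℕ)) φ)
    (hb : ∀ ζ : ℂ, ‖φ ζ‖ ≤ ‖ζ‖ ^ (p - 1))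
    (inst : NormedSpace ℝ (Lp' p)) (hinst : inst = lp.instNormedSpace) :
    (∀ z ξ : Lp' p, Summable fun ν : ℕ => ‖φ (z ν) * (starRingEnd ℂ) (ξ ν)‖) ∧
    ContDiff ℝ (p - 1 : ℕ)
      (fun x : Lp' p × Lp' p => ∑' ν : ℕ, φ (x.1 ν) * (starRingEnd ℂ) (x.2 ν)) ∧
    (∀ z ξ : Lp' p,
      ‖∑' ν : ℕ, φ (z ν) * (starRingEnd ℂ) (ξ ν)‖ ≤ ‖z‖ ^ (p - 1) * ‖ξ‖) ∧
    (2 ≤ p → ∀ z ξ η : Lp' p,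
      (Summable fun ν : ℕ => fderiv ℝ φ (z ν) (η ν) * (starRingEnd ℂ) (ξ ν)) ∧
      fderiv ℝ (fun w : Lp' p => ∑' ν : ℕ, φ (w ν) * (starRingEnd ℂ) (ξ ν)) z η =
      ∑' ν : ℕ, fderiv ℝ φ (z ν) (η ν) * (starRingEnd ℂ) (ξ ν)) := by
  subst hinst
  have := fact_div p (p-1) hp (by omega)
  have hht : ENNReal.HolderTriple ((p:ℝ≥0∞) / ((p-1:ℕ))) p 1 := by
    have h := holder_triple p (p-1) hp
    rw [Nat.sub_add_cancel hp, ENNReal.div_self (by simp; omega) (by simp)] at h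
    exact h
  obtain ⟨N, hN, hNn, hNc⟩ := nem p hp (p-1) (by omega) ℂ (p / (p-1:ℕ)) rfl φ hsm hsupp 1
    (by simpa using hb)
  let H := lp.holderL (ι := ℕ) (p := (p:ℝ≥0∞)/((p-1:ℕ))) (q := (p:ℝ≥0∞)) 1
      (fun _ => Bconj) (fun _ => Bconj_norm)
  let T := lp.dualPairing (ι := ℕ) ((p:ℝ≥0∞)/((p-1:ℕ))) (p:ℝ≥0∞)
      (fun _ => Bconj) (fun _ => Bconj_norm)
  have hH : ∀ a b ν, H a b ν = a ν * (starRingEnd ℂ) (b ν) := fun _ _ _ => rfl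
  have hT : ∀ a b, T a b = ∑' ν, a ν * (starRingEnd ℂ) (b ν) := fun _ _ => rfl
  have hsumm : ∀ (a : lp (fun _ : ℕ => ℂ) ((p:ℝ≥0∞) / ((p-1:ℕ)))) (b : Lp' p),
      Summable fun ν => ‖a ν * (starRingEnd ℂ) (b ν)‖ := by
    intro a b
    have := (lp.memℓp (H a b)).summable (by simp)
    simpa only [ENNReal.toReal_one, Real.rpow_one, hH] using this
  have hf : ∀ z ξ : Lp' p, ∑' ν : ℕ, φ (z ν) * (starRingEnd ℂ) (ξ ν) = T (N z) ξ := by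
    intro z ξ
    rw [hT]; simp only [hN]
  refine ⟨?_, ?_, ?_, ?_⟩
  · intro z ξ
    simpa only [hN] using hsumm (N z) ξ
  · simp only [hf]
    exact (T.contDiff.comp (hNc.comp contDiff_fst)).clm_apply contDiff_snd
  · intro z ξ
    have h1 : ‖∑' ν : ℕ, φ (z ν) * (starRingEnd ℂ) (ξ ν)‖ ≤ ‖H (N z) ξ‖ := by
      have := lp.norm_tsum_le (H (N z) ξ)
      simpa only [hH, hN] using this
    refine h1.trans ?_
    refine (holder_norm _ _ _ (N z) ξ (H (N z) ξ) ?_).trans ?_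
    · intro i
      rw [hH]; simp
    · gcongr
      simpa using hNn z
  · intro hp2 z ξ η
    have hNd : Differentiable ℝ N := hNc.differentiable (by simp; omega)
    have hφd : Differentiable ℝ φ := hsm.differentiable (by simp; omega)
    have hco : ∀ ν, (fderiv ℝ N z η) ν = fderiv ℝ φ (z ν) (η ν) := by
      intro ν
      have e1 : HasFDerivAt (fun w => N w ν)
          ((lp.evalCLM ℝ (fun _ : ℕ => ℂ) ((p:ℝ≥0∞)/((p-1:ℕ))) ν).comp (fderiv ℝ N z)) z :=
        (lp.evalCLM ℝ (fun _ : ℕ => ℂ) ((p:ℝ≥0∞)/((p-1:ℕ))) ν).hasFDerivAt.comp z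
          (hNd z).hasFDerivAt
      have e2 : HasFDerivAt (fun w : Lp' p => φ (w ν))
          ((fderiv ℝ φ (z ν)).comp (lp.evalCLM ℝ (fun _ : ℕ => ℂ) (p:ℝ≥0∞) ν)) z :=
        (hφd (z ν)).hasFDerivAt.comp z
          (lp.evalCLM ℝ (fun _ : ℕ => ℂ) (p:ℝ≥0∞) ν).hasFDerivAt
      simp only [hN] at e1
      exact congrArg (fun A => A η) (e1.unique e2)
    refine ⟨?_, ?_⟩
    · have := (hsumm (fderiv ℝ N z η) ξ).of_norm
      simpa only [hco] using this
    · simp only [hf]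
      have : HasFDerivAt (fun w => T (N w) ξ) ((T.flip ξ).comp (fderiv ℝ N z)) z :=
        (T.flip ξ).hasFDerivAt.comp z (hNd z).hasFDerivAt
      rw [this.fderiv]
      change T (fderiv ℝ N z η) ξ = _
      rw [hT]
      simp only [hco]

lemma dbar_pt (A : ℂ →L[ℝ] ℂ) (a : ℂ) :
    A a + Complex.I * A (Complex.I * a) = (A 1 + Complex.I * A Complex.I) * (starRingEnd ℂ) a := by
  have h : ∀ x y : ℝ, A (x + y * Complex.I) = x * A 1 + y * A Complex.I := by
    intro x y
    have : ((x:ℂ) + y * Complex.I) = x • (1:ℂ) + y • Complex.I := by simp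
    rw [this, map_add, map_smul, map_smul]
    simp
  have ha : a = (a.re : ℂ) + (a.im : ℂ) * Complex.I := (Complex.re_add_im a).symm
  have hb : Complex.I * a = ((-a.im : ℝ) : ℂ) + (a.re : ℂ) * Complex.I := by
    apply Complex.ext <;> simp
  have hc : (starRingEnd ℂ) a = (a.re : ℂ) - (a.im : ℂ) * Complex.I := by
    apply Complex.ext <;> simp
  have he : A a = a.re * A 1 + a.im * A Complex.I := by
    conv_lhs => rw [ha]
    exact h _ _
  rw [hb, h, hc, he]
  push_cast
  linear_combination ((a.im:ℂ) * A Complex.I) * Complex.I_sq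

/-- Let `p ≥ 1` and `φ : ℂ → ℂ` be compactly supported, of class `C^{p−1}`
(real sense), with `|φ(ζ)| ≤ |ζ|^{p−1}`. Then for all `z, ξ ∈ l^p` the series
`∑_ν φ(z_ν)·conj(ξ_ν)` converges absolutely; its sum `f(z)(ξ)` defines a `(0,1)`-form `f` of
class `C^{p−1}` on `l^p`; `|f|_{0,B(r)} ≤ r^{p−1}` for every `r > 0`; and if `p ≥ 2` then `f`
is `∂̄`-closed. -/
theorem statement17 (p : ℕ) (hp : 1 ≤ p) [Fact (1 ≤ (p : ℝ≥0∞))]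
    (φ : ℂ → ℂ) (hsupp : HasCompactSupport φ) (hsm : ContDiff ℝ ((p - 1 : ℕ)) φ)
    (hb : ∀ ζ : ℂ, ‖φ ζ‖ ≤ ‖ζ‖ ^ (p - 1)) :
    (∀ z ξ : Lp' p, Summable fun ν : ℕ => ‖φ (z ν) * (starRingEnd ℂ) (ξ ν)‖) ∧
    IsForm01 (p - 1) (univ : Set (Lp' p))
      (fun z ξ : Lp' p => ∑' ν : ℕ, φ (z ν) * (starRingEnd ℂ) (ξ ν)) ∧
    (∀ r : ℝ, 0 < r → ∀ z : Lp' p, ‖z‖ < r → ∀ ξ : Lp' p, ‖ξ‖ ≤ 1 →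
      ‖∑' ν : ℕ, φ (z ν) * (starRingEnd ℂ) (ξ ν)‖ ≤ r ^ (p - 1)) ∧
    (2 ≤ p → DbarClosed (univ : Set (Lp' p))
      (fun z ξ : Lp' p => ∑' ν : ℕ, φ (z ν) * (starRingEnd ℂ) (ξ ν))) := by
  obtain ⟨h1, h2, h3, h4⟩ := core p hp φ hsupp hsm hb NormedSpace.complexToReal (inst_eq p)
  refine ⟨h1, ⟨?_, ?_, ?_⟩, ?_, ?_⟩
  · intro z _ ξ η
    simp only [lp.coeFn_add, Pi.add_apply, map_add, mul_add]
    exact (h1 z ξ).of_norm.tsum_add (h1 z η).of_norm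
  · intro z _ a ξ
    rw [← tsum_mul_left]
    refine tsum_congr fun ν => ?_
    simp only [lp.coeFn_smul, Pi.smul_apply, smul_eq_mul, map_mul]
    ring
  · exact h2.contDiffOn
  · intro r hr z hz ξ hξ
    refine (h3 z ξ).trans ?_
    calc ‖z‖ ^ (p-1) * ‖ξ‖ ≤ r ^ (p-1) * 1 := by gcongr
      _ = _ := mul_one _
  · intro hp2 z _ ξ η
    have key : ∀ ξ η : Lp' p, dbar (fun w : Lp' p => ∑' ν : ℕ, φ (w ν) * (starRingEnd ℂ) (ξ ν)) z η
        = (∑' ν : ℕ, (fderiv ℝ φ (z ν) 1 + Complex.I * fderiv ℝ φ (z ν) Complex.I) *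
          (starRingEnd ℂ) (η ν) * (starRingEnd ℂ) (ξ ν)) / 2 := by
      intro ξ η
      obtain ⟨s1, e1⟩ := h4 hp2 z ξ η
      obtain ⟨s2, e2⟩ := h4 hp2 z ξ (Complex.I • η)
      refine (congrArg₂ (fun a b => (a + Complex.I * b) / 2) e1 e2).trans ?_
      simp only []
      rw [← tsum_mul_left, ← s1.tsum_add (s2.mul_left _)]
      congr 1
      refine tsum_congr fun ν => ?_
      rw [← dbar_pt]
      simp only [lp.coeFn_smul, Pi.smul_apply, smul_eq_mul]
      ring
    change dbar (fun w : Lp' p => ∑' ν : ℕ, φ (w ν) * (starRingEnd ℂ) (ξ ν)) z η =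
      dbar (fun w : Lp' p => ∑' ν : ℕ, φ (w ν) * (starRingEnd ℂ) (η ν)) z ξ
    rw [key, key]
    congr 1
    refine tsum_congr fun ν => ?_
    ring
end
end
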